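/- arXiv:1011.4611 — 3 statements merged into one kernel-verified Lean document; each statement's English description precedes it below -/
import Mathlib

section
/- Let n ≥ 2 and let Z ⊂ ℙ_n be a finite non-degenerate set of points. Then the following are equivalent: (a) there exist a point y ∈ ℙ_n \ Z and a 2×n matrix M of linear forms on ℙ_n with non-proportional rows whose first row defines y, such that Z is contained in the rank-1 locus of M; (b) Z is contained in a Kronecker–Weierstrass variety Y ⊂ ℙ_n of some type (d;s), such that if d = 0 then the distinguished point of Y does not lie in Z. -/
noncomputable section

open scoped BigOperators

/-- The set of points of `ℙ_n = ℙ(k^{n+1})` lying in the projectivization of the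
linear subspace `W ⊆ k^{n+1}`. -/
def projSet (k : Type*) [Field k] {n : ℕ} (W : Submodule k (Fin (n + 1) → k)) :
    Set (Projectivization k (Fin (n + 1) → k)) :=
  {x | x.rep ∈ W}

/-- `C ⊆ ℙ_n` is a rational normal curve of degree `d`, spanning the `d`-dimensional
linear subspace of `ℙ_n` given by the `(d+1)`-dimensional subspace `L ⊆ k^{n+1}`:
namely, `C` is the image of the degree-`d` Veronese map `ℙ¹ → ℙ_n` composed with an
injective linear map `A : k^{d+1} → k^{n+1}`, and `L = im A`. -/
def IsRNC (k : Type*) [Field k] (n d : ℕ)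
    (C : Set (Projectivization k (Fin (n + 1) → k)))
    (L : Submodule k (Fin (n + 1) → k)) : Prop :=
  ∃ A : (Fin (d + 1) → k) →ₗ[k] (Fin (n + 1) → k), Function.Injective A ∧
    L = LinearMap.range A ∧
    C = {x | ∃ s t c : k, c ≠ 0 ∧
          c • x.rep = A fun i => s ^ (d - (i : ℕ)) * t ^ (i : ℕ)}

/-- `Y ⊆ ℙ_n` is a Kronecker–Weierstrass variety of type `(d;s)` with `d ≥ 1` and
curve part `C`: there are integers `n₁, …, n_s` with `1 ≤ nᵢ ≤ n - 1` and
`d + n₁ + ⋯ + n_s = n`, a rational normal curve `C` of degree `d` spanning a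
`d`-dimensional linear subspace `L`, and linear subspaces `Lᵢ` of dimension `nᵢ`,
such that each `L ∩ Lᵢ` is a single point lying on `C`, the `Lᵢ` are pairwise
disjoint, and `Y = C ∪ L₁ ∪ ⋯ ∪ L_s`. -/
def IsKWpos (k : Type*) [Field k] (n d s : ℕ)
    (Y C : Set (Projectivization k (Fin (n + 1) → k))) : Prop :=
  1 ≤ d ∧
  ∃ (nn : Fin s → ℕ) (L : Submodule k (Fin (n + 1) → k))
    (W : Fin s → Submodule k (Fin (n + 1) → k)),
    (∀ i, 1 ≤ nn i ∧ nn i ≤ n - 1) ∧ (d + ∑ i, nn i = n) ∧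
    IsRNC k n d C L ∧
    (∀ i, Module.finrank k (W i) = nn i + 1) ∧
    (∀ i, ∃ p ∈ C, projSet k L ∩ projSet k (W i) = {p}) ∧
    (∀ i j, i ≠ j → projSet k (W i) ∩ projSet k (W j) = ∅) ∧
    Y = C ∪ ⋃ i, projSet k (W i)

/-- `Y ⊆ ℙ_n` is a Kronecker–Weierstrass variety of type `(0;s)` with distinguished
point `y`: there are integers `n₁, …, n_s` with `1 ≤ nᵢ ≤ n - 1` and
`n₁ + ⋯ + n_s = n`, and linear subspaces `Lᵢ` of dimension `nᵢ`, all passing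
through `y`, any two of which meet exactly at `y`, with `Y = L₁ ∪ ⋯ ∪ L_s`. -/
def IsKW0 (k : Type*) [Field k] (n s : ℕ)
    (Y : Set (Projectivization k (Fin (n + 1) → k)))
    (y : Projectivization k (Fin (n + 1) → k)) : Prop :=
  ∃ (nn : Fin s → ℕ) (W : Fin s → Submodule k (Fin (n + 1) → k)),
    (∀ i, 1 ≤ nn i ∧ nn i ≤ n - 1) ∧ (∑ i, nn i = n) ∧
    (∀ i, Module.finrank k (W i) = nn i + 1) ∧
    (∀ i, y ∈ projSet k (W i)) ∧
    (∀ i j, i ≠ j → projSet k (W i) ∩ projSet k (W j) = {y}) ∧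
    Y = ⋃ i, projSet k (W i)

/-- A set of points of `ℙ_n` is non-degenerate if it is not contained in any
hyperplane, i.e. no nonzero linear functional vanishes on (representatives of)
all its points. -/
def NonDegenerate (k : Type*) [Field k] (n : ℕ)
    (Z : Set (Projectivization k (Fin (n + 1) → k))) : Prop :=
  ∀ f : Module.Dual k (Fin (n + 1) → k), (∀ x ∈ Z, f x.rep = 0) → f = 0

/-- The `n` linear forms `r` (a row of a matrix of linear forms on `ℙ_n`) define the
point `y ∈ ℙ_n`: they are linearly independent over `k` and their common zero locus
in `ℙ_n` is exactly `{y}`. -/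
def RowDefinesPoint (k : Type*) [Field k] (n : ℕ)
    (r : Fin n → Module.Dual k (Fin (n + 1) → k))
    (y : Projectivization k (Fin (n + 1) → k)) : Prop :=
  LinearIndependent k r ∧
  {x : Projectivization k (Fin (n + 1) → k) | ∀ j, r j x.rep = 0} = {y}

/-- The point `z ∈ ℙ_n` lies in the rank-1 locus of the `2 × n` matrix of linear
forms `M`: the scalar matrix obtained by evaluating the entries at a representative
of `z` has rank at most 1. -/
def InRankOneLocus (k : Type*) [Field k] (n : ℕ)
    (M : Fin 2 → Fin n → Module.Dual k (Fin (n + 1) → k))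
    (z : Projectivization k (Fin (n + 1) → k)) : Prop :=
  (Matrix.of fun i j => M i j z.rep : Matrix (Fin 2) (Fin n) k).rank ≤ 1

namespace KW

open scoped Polynomial
open Polynomial (X C)

section Coordinates

variable {k : Type*} [Field k] {ι : Type*}

/-- In coordinates where the pencil `(a, b)` acts by `a eᵢ ↦ lᵢ a eᵢ` and `ker a` is spanned by
`c`, this is the kernel of `b - ρ a`. -/
def eigenSpace (l c : ι → k) (ρ : k) : Submodule k (ι → k) where
  carrier := {x | ∃ μ, ∀ i, x i * (l i - ρ) = μ * c i}
  add_mem' := by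
    rintro x y ⟨μ, hμ⟩ ⟨ν, hν⟩
    refine ⟨μ + ν, fun i => ?_⟩
    rw [Pi.add_apply, add_mul, add_mul, hμ, hν]
  zero_mem' := ⟨0, by simp⟩
  smul_mem' := by
    rintro r x ⟨μ, hμ⟩
    refine ⟨r * μ, fun i => ?_⟩
    rw [Pi.smul_apply, smul_eq_mul, mul_assoc, hμ, mul_assoc]

theorem mem_eigenSpace {l c : ι → k} {ρ : k} {x : ι → k} :
    x ∈ eigenSpace l c ρ ↔ ∃ μ, ∀ i, x i * (l i - ρ) = μ * c i := Iff.rfl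

theorem mem_span_of_mem_eigenSpace_of_ne {l c : ι → k} {ρ σ : k} (h : ρ ≠ σ) {x : ι → k}
    (hρ : x ∈ eigenSpace l c ρ) (hσ : x ∈ eigenSpace l c σ) : x ∈ Submodule.span k {c} := by
  obtain ⟨μ, hμ⟩ := hρ
  obtain ⟨ν, hν⟩ := hσ
  have h' : σ - ρ ≠ 0 := sub_ne_zero.2 h.symm
  refine Submodule.mem_span_singleton.2 ⟨(μ - ν) / (σ - ρ), funext fun i => ?_⟩
  rw [Pi.smul_apply, smul_eq_mul]
  field_simp
  linear_combination hν i - hμ i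

variable [Fintype ι] [DecidableEq k]

/-- The values of `l` on the support of `c`. -/
def nodes (l c : ι → k) : Finset k := (Finset.univ.filter (c · ≠ 0)).image l

theorem mem_nodes {l c : ι → k} {κ : k} : κ ∈ nodes l c ↔ ∃ i, c i ≠ 0 ∧ l i = κ := by
  simp [nodes]

theorem apply_mem_nodes {l c : ι → k} {i : ι} (h : c i ≠ 0) : l i ∈ nodes l c :=
  mem_nodes.2 ⟨i, h, rfl⟩

theorem nodes_nonempty {l c : ι → k} (hc : c ≠ 0) : (nodes l c).Nonempty := by
  obtain ⟨i, hi⟩ := Function.ne_iff.1 hc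
  exact ⟨_, apply_mem_nodes hi⟩

/-- The point with parameter `ρ` of the rational normal curve attached to `(l, c)`. -/
def curvePoint (l c : ι → k) (ρ : k) : ι → k :=
  fun i => c i * ∏ κ ∈ (nodes l c).erase (l i), (ρ - κ)

theorem curvePoint_mem (l c : ι → k) (ρ : k) : curvePoint l c ρ ∈ eigenSpace l c ρ := by
  refine ⟨-∏ κ ∈ nodes l c, (ρ - κ), fun i => ?_⟩
  rcases eq_or_ne (c i) 0 with h | h
  · simp [curvePoint, h]
  · rw [← Finset.mul_prod_erase _ _ (apply_mem_nodes h), curvePoint]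
    ring

theorem exists_curvePoint_ne_zero (l : ι → k) {c : ι → k} (hc : c ≠ 0) (ρ : k) :
    ∃ i, curvePoint l c ρ i ≠ 0 := by
  have key : ∃ i, c i ≠ 0 ∧ ρ ∉ (nodes l c).erase (l i) := by
    by_cases h : ρ ∈ nodes l c
    · obtain ⟨i, hi, rfl⟩ := mem_nodes.1 h
      exact ⟨i, hi, Finset.notMem_erase _ _⟩
    · obtain ⟨i, hi⟩ := Function.ne_iff.1 hc
      exact ⟨i, hi, fun h' => h (Finset.mem_of_mem_erase h')⟩
  obtain ⟨i, hi, hρ⟩ := key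
  refine ⟨i, mul_ne_zero hi (Finset.prod_ne_zero_iff.2 fun κ hκ => sub_ne_zero.2 ?_)⟩
  rintro rfl
  exact hρ hκ

theorem curvePoint_ne_zero (l : ι → k) {c : ι → k} (hc : c ≠ 0) (ρ : k) :
    curvePoint l c ρ ≠ 0 :=
  Function.ne_iff.2 (exists_curvePoint_ne_zero l hc ρ)

theorem curvePoint_eq_of_card_nodes_eq_one {l c : ι → k} (h : (nodes l c).card = 1) (ρ : k) :
    curvePoint l c ρ = c := by
  funext i
  rcases eq_or_ne (c i) 0 with hi | hi
  · simp [curvePoint, hi]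
  · have : (nodes l c).erase (l i) = ∅ := by
      rw [← Finset.card_eq_zero, Finset.card_erase_of_mem (apply_mem_nodes hi), h]
    simp [curvePoint, this]

/-- The linear map sending the degree-`d` Veronese curve to the curve `curvePoint l c`. -/
def curveMap (l c : ι → k) (d : ℕ) : (Fin (d + 1) → k) →ₗ[k] (ι → k) :=
  LinearMap.pi fun i => c i • ∑ j : Fin (d + 1),
    (∏ κ ∈ (nodes l c).erase (l i), (X - C κ)).coeff j • LinearMap.proj j

theorem curveMap_apply (l c : ι → k) (d : ℕ) (x : Fin (d + 1) → k) (i : ι) :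
    curveMap l c d x i = c i * ∑ j : Fin (d + 1),
      (∏ κ ∈ (nodes l c).erase (l i), (X - C κ)).coeff j * x j := by
  simp [curveMap]

theorem curveMap_veronese {l c : ι → k} {d : ℕ} (hd : (nodes l c).card = d + 1) (t : k) :
    curveMap l c d (fun j => 1 ^ (d - (j : ℕ)) * t ^ (j : ℕ)) = curvePoint l c t := by
  funext i
  rw [curveMap_apply, curvePoint]
  rcases eq_or_ne (c i) 0 with hi | hi
  · simp [hi]
  · congr 1
    have hdeg : (∏ κ ∈ (nodes l c).erase (l i), (X - C κ)).natDegree < d + 1 := by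
      rw [Polynomial.natDegree_finsetProd_X_sub_C_eq_card,
        Finset.card_erase_of_mem (apply_mem_nodes hi), hd]
      omega
    have := Polynomial.eval_eq_sum_range' hdeg t
    rw [Polynomial.eval_prod, Finset.sum_range] at this
    simpa using this.symm

theorem curveMap_injective {l c : ι → k} {d : ℕ} (hd : (nodes l c).card = d + 1) :
    Function.Injective (curveMap l c d) := by
  rw [← LinearMap.ker_eq_bot, LinearMap.ker_eq_bot']
  intro x hx
  let φ : k[X] →ₗ[k] k := ∑ j : Fin (d + 1), x j • Polynomial.lcoeff k j
  have hφ (f : k[X]) : φ f = ∑ j : Fin (d + 1), f.coeff j * x j := by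
    simp [φ, mul_comm]
  have hbasis : ∀ κ ∈ nodes l c, φ (Lagrange.basis (nodes l c) id κ) = 0 := by
    intro κ hκ
    obtain ⟨i, hi, rfl⟩ := mem_nodes.1 hκ
    have h0 := congrFun hx i
    rw [curveMap_apply, ← hφ, Pi.zero_apply] at h0
    have : Lagrange.basis (nodes l c) id (l i) =
        (∏ κ ∈ (nodes l c).erase (l i), (l i - κ)⁻¹) •
          ∏ κ ∈ (nodes l c).erase (l i), (X - C κ) := by
      rw [Polynomial.smul_eq_C_mul, map_prod, ← Finset.prod_mul_distrib]
      rfl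
    rw [this, map_smul, (mul_eq_zero.1 h0).resolve_left hi, smul_zero]
  funext j
  have hX : φ (X ^ (j : ℕ)) = x j := by
    rw [hφ, Finset.sum_eq_single j] <;>
      simp +contextual [Polynomial.coeff_X_pow, Fin.ext_iff]
  have hdeg : (X ^ (j : ℕ) : k[X]).degree < (nodes l c).card := by
    rw [Polynomial.degree_X_pow, hd]
    exact_mod_cast j.2
  rw [Pi.zero_apply, ← hX, Lagrange.eq_interpolate (s := nodes l c) (v := id)
    Function.injective_id.injOn hdeg, Lagrange.interpolate_apply, map_sum]
  refine Finset.sum_eq_zero fun κ hκ => ?_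
  rw [← Polynomial.smul_eq_C_mul, map_smul, hbasis κ hκ, smul_zero]

theorem mem_span_curvePoint {l c : ι → k} (hc : c ≠ 0) {d : ℕ} {ρ : k} {x : ι → k}
    (hL : x ∈ LinearMap.range (curveMap l c d)) (hW : x ∈ eigenSpace l c ρ) :
    x ∈ Submodule.span k {curvePoint l c ρ} := by
  obtain ⟨i₀, hi₀⟩ := exists_curvePoint_ne_zero l hc ρ
  suffices h : ∀ i, x i * curvePoint l c ρ i₀ = x i₀ * curvePoint l c ρ i by
    refine Submodule.mem_span_singleton.2 ⟨x i₀ / curvePoint l c ρ i₀, funext fun i => ?_⟩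
    rw [Pi.smul_apply, smul_eq_mul, div_mul_eq_mul_div, ← h i, mul_div_cancel_right₀ _ hi₀]
  obtain ⟨q, hq⟩ : ∃ q : k → k, ∀ i, x i = c i * q (l i) := by
    obtain ⟨y, rfl⟩ := hL
    exact ⟨fun κ => ∑ j : Fin (d + 1),
      (∏ κ' ∈ (nodes l c).erase κ, (X - C κ')).coeff j * y j, curveMap_apply l c d y⟩
  obtain ⟨μ, hμ⟩ := hW
  have hqμ : ∀ i, c i ≠ 0 → q (l i) * (l i - ρ) = μ := by
    intro i hi
    have := hμ i
    rw [hq] at this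
    exact mul_left_cancel₀ hi (by linear_combination this)
  have hi₀c : c i₀ ≠ 0 := left_ne_zero_of_mul hi₀
  have hi₀P := right_ne_zero_of_mul hi₀
  intro i
  rcases eq_or_ne (c i) 0 with hi | hi
  · rw [hq i]
    simp [curvePoint, hi]
  suffices h : q (l i) * ∏ κ ∈ (nodes l c).erase (l i₀), (ρ - κ) =
      q (l i₀) * ∏ κ ∈ (nodes l c).erase (l i), (ρ - κ) by
    rw [hq i, hq i₀, curvePoint, curvePoint]
    linear_combination c i * c i₀ * h
  rcases eq_or_ne (l i) (l i₀) with he | he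
  · rw [he]
  by_cases hρ : ρ ∈ nodes l c
  · have hρ₀ : ρ = l i₀ := by
      by_contra hne
      exact hi₀P (Finset.prod_eq_zero (Finset.mem_erase.2 ⟨hne, hρ⟩) (sub_self ρ))
    have hμ0 : μ = 0 := by rw [← hqμ i₀ hi₀c, hρ₀, sub_self, mul_zero]
    have hqi : q (l i) = 0 := by
      have := hqμ i hi
      rw [hμ0, hρ₀] at this
      exact (mul_eq_zero.1 this).resolve_right (sub_ne_zero.2 he)
    have hne : ρ ≠ l i := fun h => he (h.symm.trans hρ₀)
    rw [hqi, Finset.prod_eq_zero (Finset.mem_erase.2 ⟨hne, hρ⟩) (sub_self ρ), zero_mul, mul_zero]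
  · have h1 : l i - ρ ≠ 0 := sub_ne_zero.2 fun h => hρ (h ▸ apply_mem_nodes hi)
    have h2 : l i₀ - ρ ≠ 0 := sub_ne_zero.2 fun h => hρ (h ▸ apply_mem_nodes hi₀c)
    have e1 := Finset.mul_prod_erase _ (fun κ => ρ - κ) (apply_mem_nodes (l := l) hi)
    have e2 := Finset.mul_prod_erase _ (fun κ => ρ - κ) (apply_mem_nodes (l := l) hi₀c)
    refine mul_left_cancel₀ (mul_ne_zero h1 h2) ?_
    linear_combination (∏ κ ∈ (nodes l c).erase (l i₀), (ρ - κ)) * (l i₀ - ρ) * hqμ i hi -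
      (∏ κ ∈ (nodes l c).erase (l i), (ρ - κ)) * (l i - ρ) * hqμ i₀ hi₀c - μ * e2 + μ * e1

/-- The vectors with prescribed entries at the indices `i` with `l i = ρ`, the other entries being
determined by the equations of `eigenSpace l c ρ`. -/
def eigenParam (l c : ι → k) (ρ : k) : (({i // l i = ρ} → k) × k) →ₗ[k] (ι → k) where
  toFun p i := if h : l i = ρ then p.1 ⟨i, h⟩ else p.2 * c i / (l i - ρ)
  map_add' p q := by
    funext i
    by_cases h : l i = ρ <;> simp [h, add_mul, add_div]
  map_smul' r p := by
    funext i
    by_cases h : l i = ρ <;> simp [h, mul_assoc, mul_div_assoc]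

theorem finrank_eigenSpace {l c : ι → k} (hc : c ≠ 0) (ρ : k) :
    Module.finrank k (eigenSpace l c ρ) =
      (Finset.univ.filter (l · = ρ)).card - (if ρ ∈ nodes l c then 1 else 0) + 1 := by
  have hN : Fintype.card {i // l i = ρ} = (Finset.univ.filter (l · = ρ)).card :=
    Fintype.card_subtype _
  have hpar (x : ι → k) (hx : x ∈ eigenSpace l c ρ) :
      ∃ μ, (∀ i, x i * (l i - ρ) = μ * c i) ∧ eigenParam l c ρ (fun i => x i, μ) = x := by
    obtain ⟨μ, hμ⟩ := hx
    refine ⟨μ, hμ, funext fun i => ?_⟩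
    by_cases h : l i = ρ
    · simp [eigenParam, h]
    · simp only [eigenParam, LinearMap.coe_mk, AddHom.coe_mk, h, dite_false]
      rw [← hμ i, mul_div_cancel_right₀ _ (sub_ne_zero.2 h)]
  have hfst (p) (hp : eigenParam l c ρ p = 0) : p.1 = 0 := by
    funext i
    simpa [eigenParam, i.2] using congrFun hp i
  split_ifs with hρ
  · obtain ⟨i₀, hi₀, hl₀⟩ := mem_nodes.1 hρ
    have hrange : eigenSpace l c ρ =
        LinearMap.range (eigenParam l c ρ ∘ₗ LinearMap.inl k ({i // l i = ρ} → k) k) := by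
      ext x
      constructor
      · intro hx
        obtain ⟨μ, hμ, hx⟩ := hpar x hx
        have : μ = 0 := by
          have := hμ i₀
          rw [hl₀, sub_self, mul_zero] at this
          exact (mul_eq_zero.1 this.symm).resolve_right hi₀
        subst this
        exact ⟨_, hx⟩
      · rintro ⟨f, rfl⟩
        refine ⟨0, fun i => ?_⟩
        by_cases h : l i = ρ <;> simp [eigenParam, h]
    have hinj : Function.Injective
        (eigenParam l c ρ ∘ₗ LinearMap.inl k ({i // l i = ρ} → k) k) := by
      rw [← LinearMap.ker_eq_bot, LinearMap.ker_eq_bot']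
      exact fun f hf => hfst _ hf
    rw [hrange, LinearMap.finrank_range_of_inj hinj, Module.finrank_pi, hN]
    have : 0 < (Finset.univ.filter (l · = ρ)).card :=
      Finset.card_pos.2 ⟨i₀, by simpa using hl₀⟩
    omega
  · have hrange : eigenSpace l c ρ = LinearMap.range (eigenParam l c ρ) := by
      ext x
      constructor
      · intro hx
        obtain ⟨μ, hμ, hx⟩ := hpar x hx
        exact ⟨_, hx⟩
      · rintro ⟨f, rfl⟩
        refine ⟨f.2, fun i => ?_⟩
        by_cases h : l i = ρ
        · have : c i = 0 := by
            by_contra hi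
            exact hρ (mem_nodes.2 ⟨i, hi, h⟩)
          simp [h, this]
        · simp [eigenParam, h, sub_ne_zero.2 h]
    have hinj : Function.Injective (eigenParam l c ρ) := by
      rw [← LinearMap.ker_eq_bot, LinearMap.ker_eq_bot']
      intro p hp
      refine Prod.ext (hfst p hp) ?_
      obtain ⟨i, hi⟩ := Function.ne_iff.1 hc
      have hl : l i ≠ ρ := fun h => hρ (mem_nodes.2 ⟨i, hi, h⟩)
      simpa [eigenParam, hl, sub_ne_zero.2 hl, show c i ≠ 0 from hi] using congrFun hp i
    rw [hrange, LinearMap.finrank_range_of_inj hinj, Module.finrank_prod, Module.finrank_pi, hN,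
      Module.finrank_self, Nat.sub_zero]

theorem not_mem_eigenSpace_of_one_lt_card {l c : ι → k} (h : 1 < (nodes l c).card) (ρ : k) :
    c ∉ eigenSpace l c ρ := by
  rintro ⟨μ, hμ⟩
  obtain ⟨κ, hκ, κ', hκ', hne⟩ := Finset.one_lt_card.1 h
  obtain ⟨i, hi, rfl⟩ := mem_nodes.1 hκ
  obtain ⟨j, hj, rfl⟩ := mem_nodes.1 hκ'
  have h1 : l i - ρ = μ := mul_left_cancel₀ hi (by rw [hμ, mul_comm])
  have h2 : l j - ρ = μ := mul_left_cancel₀ hj (by rw [hμ, mul_comm])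
  exact hne (by linear_combination h1 - h2)

theorem sum_card_fiber_sub_add_card_nodes (l c : ι → k) :
    (∑ ρ ∈ Finset.univ.image l, ((Finset.univ.filter (l · = ρ)).card -
      (if ρ ∈ nodes l c then 1 else 0))) + (nodes l c).card = Fintype.card ι := by
  have h1 : (nodes l c).card = ∑ ρ ∈ Finset.univ.image l, (if ρ ∈ nodes l c then 1 else 0) := by
    rw [← Finset.sum_filter, ← Finset.card_eq_sum_ones]
    congr 1
    ext ρ
    simp only [Finset.mem_filter, Finset.mem_image, Finset.mem_univ, true_and]
    refine ⟨fun h => ⟨?_, h⟩, And.right⟩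
    obtain ⟨i, -, hi⟩ := mem_nodes.1 h
    exact ⟨i, hi⟩
  rw [h1, ← Finset.sum_add_distrib, ← Finset.card_univ,
    Finset.card_eq_sum_card_image l Finset.univ]
  refine Finset.sum_congr rfl fun ρ hρ => ?_
  obtain ⟨i, -, hi⟩ := Finset.mem_image.1 hρ
  have : 0 < (Finset.univ.filter (l · = ρ)).card := Finset.card_pos.2 ⟨i, by simpa using hi⟩
  split_ifs <;> omega

end Coordinates

section Projective

variable {k : Type*} [Field k] {n : ℕ}

theorem eq_mk_iff_rep_mem_span {x : Projectivization k (Fin (n + 1) → k)} {v : Fin (n + 1) → k}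
    (hv : v ≠ 0) : x = Projectivization.mk k v hv ↔ x.rep ∈ Submodule.span k {v} := by
  rw [Submodule.mem_span_singleton]
  conv_lhs => rw [← x.mk_rep]
  exact Projectivization.mk_eq_mk_iff' k _ _ _ _

theorem eq_of_rep_mem_span_rep {x y : Projectivization k (Fin (n + 1) → k)}
    (h : x.rep ∈ Submodule.span k {y.rep}) : x = y := by
  rw [← y.mk_rep]
  exact (eq_mk_iff_rep_mem_span y.rep_nonzero).2 h

theorem rep_mk_mem_iff {v : Fin (n + 1) → k} (hv : v ≠ 0) (W : Submodule k (Fin (n + 1) → k)) :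
    (Projectivization.mk k v hv).rep ∈ W ↔ v ∈ W := by
  obtain ⟨r, hr⟩ := Projectivization.exists_smul_eq_mk_rep k v hv
  rw [← hr]
  exact W.smul_mem_iff' r

theorem projSet_inter_eq_singleton {W W' : Submodule k (Fin (n + 1) → k)} {v : Fin (n + 1) → k}
    (hv : v ≠ 0) (hW : v ∈ W) (hW' : v ∈ W')
    (h : ∀ x ∈ W, x ∈ W' → x ∈ Submodule.span k {v}) :
    projSet k W ∩ projSet k W' = {Projectivization.mk k v hv} := by
  ext x
  rw [Set.mem_singleton_iff]
  constructor
  · rintro ⟨h1, h2⟩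
    exact (eq_mk_iff_rep_mem_span hv).2 (h _ h1 h2)
  · rintro rfl
    exact ⟨(rep_mk_mem_iff hv W).2 hW, (rep_mk_mem_iff hv W').2 hW'⟩

theorem span_rep_eq_top {Z : Set (Projectivization k (Fin (n + 1) → k))}
    (hnd : NonDegenerate k n Z) :
    Submodule.span k (Projectivization.rep '' Z) = ⊤ := by
  by_contra h
  obtain ⟨f, hf, hle⟩ := Submodule.exists_le_ker_of_lt_top _ (lt_top_iff_ne_top.2 h)
  exact hf (hnd f fun x hx => hle (Submodule.subset_span ⟨x, hx, rfl⟩))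

theorem exists_basis_of_nonDegenerate {Z : Set (Projectivization k (Fin (n + 1) → k))}
    (hnd : NonDegenerate k n Z) :
    ∃ v : Module.Basis (Fin (n + 1)) k (Fin (n + 1) → k), ∀ i, ∃ z ∈ Z, v i = z.rep := by
  let B := Module.Basis.ofSpan (span_rep_eq_top hnd).ge
  let e := B.indexEquiv (Pi.basisFun k (Fin (n + 1)))
  refine ⟨B.reindex e, fun i => ?_⟩
  obtain ⟨z, hz, h⟩ := Module.Basis.ofSpan_subset (span_rep_eq_top hnd).ge
    ⟨e.symm i, (B.reindex_apply e i).symm⟩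
  exact ⟨z, hz, h.symm⟩

theorem inRankOneLocus_iff (M : Fin 2 → Fin n → Module.Dual k (Fin (n + 1) → k))
    (z : Projectivization k (Fin (n + 1) → k)) :
    InRankOneLocus k n M z ↔ ∃ s t : k, (s ≠ 0 ∨ t ≠ 0) ∧
      ∀ j, s * M 0 j z.rep + t * M 1 j z.rep = 0 := by
  have h : InRankOneLocus k n M z ↔ ¬ LinearIndependent k (fun i j => M i j z.rep) := by
    rw [InRankOneLocus, Matrix.rank_eq_finrank_span_row, linearIndependent_iff_card_le_finrank_span,
      Fintype.card_fin, not_le, Nat.lt_succ_iff]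
    rfl
  have h2 : (fun i j => M i j z.rep) = ![fun j => M 0 j z.rep, fun j => M 1 j z.rep] := by
    funext i
    fin_cases i <;> rfl
  rw [h, h2, LinearIndependent.pair_iff]
  push Not
  refine exists_congr fun s => exists_congr fun t => ?_
  rw [funext_iff, and_comm, ← imp_iff_not_or]
  rfl

end Projective

section PencilToVariety

variable {k : Type*} [Field k] {n : ℕ}

theorem apply_eq_smul_apply_iff_mem_eigenSpace {ι V U : Type*} [Fintype ι] [AddCommGroup V]
    [Module k V] [AddCommGroup U] [Module k U] (v : Module.Basis ι k V) (a b : V →ₗ[k] U)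
    {l : ι → k} (hl : ∀ i, b (v i) = l i • a (v i)) {y : V}
    (hy : LinearMap.ker a = Submodule.span k {y}) {x : V} {ρ : k} :
    b x = ρ • a x ↔ v.equivFun x ∈ eigenSpace l (v.equivFun y) ρ := by
  have key : a (v.equivFun.symm fun i => v.equivFun x i * (l i - ρ)) = b x - ρ • a x := by
    conv_rhs => rw [← v.sum_equivFun x]
    simp only [v.equivFun_symm_apply, map_sum, map_smul, hl, Finset.smul_sum,
      ← Finset.sum_sub_distrib]
    refine Finset.sum_congr rfl fun i _ => ?_
    module
  rw [← sub_eq_zero, ← key, ← LinearMap.mem_ker, hy, Submodule.mem_span_singleton, mem_eigenSpace]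
  refine exists_congr fun μ => ?_
  rw [LinearEquiv.eq_symm_apply, map_smul, funext_iff]
  exact forall_congr' fun i => eq_comm

open Classical in
/-- The dimension of the linear component with parameter `ρ` of the variety attached to
`(l, c)`. -/
def componentDim {ι : Type*} [Fintype ι] (l c : ι → k) (ρ : k) : ℕ :=
  (Finset.univ.filter (l · = ρ)).card - (if ρ ∈ nodes l c then 1 else 0)

theorem exists_kw_of_forall_mem_eigenSpace {l c : Fin (n + 1) → k}
    (e : (Fin (n + 1) → k) ≃ₗ[k] (Fin (n + 1) → k))
    {Z : Set (Projectivization k (Fin (n + 1) → k))} {y : Projectivization k (Fin (n + 1) → k)}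
    (hyZ : y ∉ Z) (hy : e y.rep = c) (hZ : ∀ z ∈ Z, ∃ ρ, e z.rep ∈ eigenSpace l c ρ)
    (htop : ∀ ρ, eigenSpace l c ρ ≠ ⊤) :
    ∃ (d s : ℕ) (Y : Set (Projectivization k (Fin (n + 1) → k))), Z ⊆ Y ∧
      ((∃ C, IsKWpos k n d s Y C) ∨ (d = 0 ∧ ∃ y, IsKW0 k n s Y y ∧ y ∉ Z)) := by
  classical
  have hc : c ≠ 0 := by
    rw [← hy]
    exact e.map_ne_zero_iff.2 y.rep_nonzero
  obtain ⟨d, hd⟩ : ∃ d, (nodes l c).card = d + 1 :=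
    Nat.exists_eq_succ_of_ne_zero (Finset.card_ne_zero.2 (nodes_nonempty hc))
  let W : k → Submodule k (Fin (n + 1) → k) := fun ρ =>
    (eigenSpace l c ρ).map (e.symm : (Fin (n + 1) → k) →ₗ[k] _)
  have hW {x ρ} : x ∈ W ρ ↔ e x ∈ eigenSpace l c ρ := Submodule.mem_map_equiv _
  have hfinrank (ρ) : Module.finrank k (eigenSpace l c ρ) = componentDim l c ρ + 1 :=
    finrank_eigenSpace hc ρ
  have hWfinrank (ρ) : Module.finrank k (W ρ) = componentDim l c ρ + 1 := by
    rw [← hfinrank]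
    exact LinearEquiv.finrank_map_eq _ _
  let G := (Finset.univ.image l).filter (componentDim l c · ≠ 0)
  let g : Fin G.card → k := fun i => (G.equivFin.symm i).1
  have hg : Function.Injective g := Subtype.val_injective.comp G.equivFin.symm.injective
  have hg0 (i) : 1 ≤ componentDim l c (g i) :=
    Nat.one_le_iff_ne_zero.2 (Finset.mem_filter.1 (G.equivFin.symm i).2).2
  have hsum : d + ∑ i, componentDim l c (g i) = n := by
    have h1 : ∑ i, componentDim l c (g i) = ∑ ρ ∈ Finset.univ.image l, componentDim l c ρ := by
      rw [← Finset.sum_filter_ne_zero (s := Finset.univ.image l), ← Finset.sum_coe_sort G]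
      exact Equiv.sum_comp G.equivFin.symm (fun ρ : G => componentDim l c ρ.1)
    have h2 := sum_card_fiber_sub_add_card_nodes l c
    rw [hd, Fintype.card_fin] at h2
    change ∑ ρ ∈ Finset.univ.image l, componentDim l c ρ + (d + 1) = n + 1 at h2
    omega
  have hcover : ∀ z ∈ Z, (∃ i, z.rep ∈ W (g i)) ∨
      ∃ ρ, e z.rep ∈ Submodule.span k {curvePoint l c ρ} := by
    intro z hz
    obtain ⟨ρ, hρ⟩ := hZ z hz
    by_cases h0 : componentDim l c ρ = 0
    · right
      refine ⟨ρ, ?_⟩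
      have h1 := hfinrank ρ
      rw [h0, zero_add] at h1
      obtain ⟨r, hr⟩ := (finrank_eq_one_iff_of_nonzero' (⟨_, curvePoint_mem l c ρ⟩ : eigenSpace l c ρ)
        (fun h => curvePoint_ne_zero l hc ρ (congrArg Subtype.val h))).1 h1 ⟨_, hρ⟩
      exact Submodule.mem_span_singleton.2 ⟨r, congrArg Subtype.val hr⟩
    · left
      have hG : ρ ∈ G := by
        refine Finset.mem_filter.2 ⟨?_, h0⟩
        have : 0 < (Finset.univ.filter (l · = ρ)).card := by
          rw [componentDim] at h0
          omega
        obtain ⟨i, hi⟩ := Finset.card_pos.1 this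
        exact Finset.mem_image.2 ⟨i, Finset.mem_univ _, (Finset.mem_filter.1 hi).2⟩
      refine ⟨G.equivFin ⟨ρ, hG⟩, hW.2 ?_⟩
      simpa [g] using hρ
  have hspan {x v} (h : e x ∈ Submodule.span k {v}) : x ∈ Submodule.span k {e.symm v} := by
    obtain ⟨r, hr⟩ := Submodule.mem_span_singleton.1 h
    exact Submodule.mem_span_singleton.2 ⟨r, by rw [← map_smul, hr, e.symm_apply_apply]⟩
  have hysymm : e.symm c = y.rep := by rw [← hy, e.symm_apply_apply]
  rcases Nat.eq_zero_or_pos d with rfl | hdpos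
  · have hcurve (ρ) : curvePoint l c ρ = c := curvePoint_eq_of_card_nodes_eq_one hd ρ
    refine ⟨0, G.card, ⋃ i, projSet k (W (g i)), fun z hz => ?_, Or.inr ⟨rfl, y, ?_, hyZ⟩⟩
    · rcases hcover z hz with ⟨i, hi⟩ | ⟨ρ, hρ⟩
      · exact Set.mem_iUnion.2 ⟨i, hi⟩
      · rw [hcurve] at hρ
        have := hspan hρ
        rw [hysymm] at this
        exact absurd (eq_of_rep_mem_span_rep this ▸ hz) hyZ
    · have hyW (ρ) : y.rep ∈ W ρ := by
        rw [hW, hy]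
        simpa only [hcurve] using curvePoint_mem l c ρ
      refine ⟨fun i => componentDim l c (g i), fun i => W (g i), fun i => ⟨hg0 i, ?_⟩,
        by rwa [zero_add] at hsum,
        fun i => hWfinrank _, fun i => hyW _, fun i j hij => ?_, rfl⟩
      · have h1 : Module.finrank k (eigenSpace l c (g i)) < n + 1 := by
          have := Submodule.finrank_lt (htop (g i))
          rwa [Module.finrank_fin_fun] at this
        rw [hfinrank] at h1
        exact Nat.le_sub_one_of_lt (Nat.succ_lt_succ_iff.1 h1)
      · have := projSet_inter_eq_singleton y.rep_nonzero (hyW (g i)) (hyW (g j)) fun x hi hj => by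
          rw [← hysymm]
          exact hspan (mem_span_of_mem_eigenSpace_of_ne (hg.ne hij) (hW.1 hi) (hW.1 hj))
        rwa [y.mk_rep] at this
  · let A := (e.symm : (Fin (n + 1) → k) →ₗ[k] (Fin (n + 1) → k)) ∘ₗ curveMap l c d
    have hA (t : k) : A (fun j => 1 ^ (d - (j : ℕ)) * t ^ (j : ℕ)) = e.symm (curvePoint l c t) :=
      congrArg e.symm (curveMap_veronese hd t)
    let C : Set (Projectivization k (Fin (n + 1) → k)) := {x | ∃ s t c : k, c ≠ 0 ∧
      c • x.rep = A fun i => s ^ (d - (i : ℕ)) * t ^ (i : ℕ)}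
    have hC {x : Projectivization k (Fin (n + 1) → k)} {ρ : k}
        (hx : x.rep ∈ Submodule.span k {e.symm (curvePoint l c ρ)}) : x ∈ C := by
      obtain ⟨r, hr⟩ := Submodule.mem_span_singleton.1 hx
      have hr0 : r ≠ 0 := by
        rintro rfl
        exact x.rep_nonzero (by rw [← hr, zero_smul])
      exact ⟨1, ρ, r⁻¹, inv_ne_zero hr0, by rw [hA, ← hr, inv_smul_smul₀ hr0]⟩
    refine ⟨d, G.card, C ∪ ⋃ i, projSet k (W (g i)), fun z hz => ?_, Or.inl ⟨C, hdpos,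
      fun i => componentDim l c (g i), LinearMap.range A, fun i => W (g i), fun i => ⟨hg0 i, ?_⟩,
      hsum, ⟨A, e.symm.injective.comp (curveMap_injective hd), rfl, rfl⟩, fun i => hWfinrank _,
      fun i => ?_, fun i j hij => ?_, rfl⟩⟩
    · rcases hcover z hz with ⟨i, hi⟩ | ⟨ρ, hρ⟩
      · exact Or.inr (Set.mem_iUnion.2 ⟨i, hi⟩)
      · exact Or.inl (hC (hspan hρ))
    · have := Finset.single_le_sum (f := fun i => componentDim l c (g i))
        (fun _ _ => Nat.zero_le _) (Finset.mem_univ i)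
      exact (show componentDim l c (g i) ≤ n - 1 by omega)
    · have hp0 : e.symm (curvePoint l c (g i)) ≠ 0 :=
        e.symm.map_ne_zero_iff.2 (curvePoint_ne_zero l hc _)
      refine ⟨Projectivization.mk k _ hp0, hC ((eq_mk_iff_rep_mem_span hp0).1 rfl),
        projSet_inter_eq_singleton hp0 ⟨_, hA _⟩ ?_ fun x hx hxW => ?_⟩
      · rw [hW, e.apply_symm_apply]
        exact curvePoint_mem l c _
      · refine hspan (mem_span_curvePoint (d := d) hc ?_ (hW.1 hxW))
        obtain ⟨u, rfl⟩ := hx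
        exact ⟨u, (e.apply_symm_apply _).symm⟩
    · rw [Set.eq_empty_iff_forall_notMem]
      rintro x ⟨hxi, hxj⟩
      have h1 := hspan (mem_span_of_mem_eigenSpace_of_ne (hg.ne hij) (hW.1 hxi) (hW.1 hxj))
      rw [hysymm] at h1
      have hxi' := hW.1 hxi
      rw [eq_of_rep_mem_span_rep h1, hy] at hxi'
      exact not_mem_eigenSpace_of_one_lt_card (by omega) _ hxi'

theorem exists_kw_of_pencil {Z : Set (Projectivization k (Fin (n + 1) → k))}
    (hnd : NonDegenerate k n Z) {y : Projectivization k (Fin (n + 1) → k)} (hyZ : y ∉ Z)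
    {M : Fin 2 → Fin n → Module.Dual k (Fin (n + 1) → k)} (hM : LinearIndependent k M)
    (hy : RowDefinesPoint k n (M 0) y) (hZ : ∀ z ∈ Z, InRankOneLocus k n M z) :
    ∃ (d s : ℕ) (Y : Set (Projectivization k (Fin (n + 1) → k))), Z ⊆ Y ∧
      ((∃ C, IsKWpos k n d s Y C) ∨ (d = 0 ∧ ∃ y, IsKW0 k n s Y y ∧ y ∉ Z)) := by
  let a : (Fin (n + 1) → k) →ₗ[k] (Fin n → k) := LinearMap.pi (M 0)
  let b : (Fin (n + 1) → k) →ₗ[k] (Fin n → k) := LinearMap.pi (M 1)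
  have hker {x : Projectivization k (Fin (n + 1) → k)} : a x.rep = 0 ↔ x = y := by
    rw [← Set.mem_singleton_iff (a := x), ← hy.2, funext_iff]
    rfl
  have hkera : LinearMap.ker a = Submodule.span k {y.rep} := by
    refine le_antisymm (fun x hx => ?_) ?_
    · by_cases hx0 : x = 0
      · rw [hx0]
        exact zero_mem _
      · have h : (Projectivization.mk k x hx0).rep ∈ LinearMap.ker a :=
          (rep_mk_mem_iff hx0 _).2 hx
        rw [← rep_mk_mem_iff hx0, hker.1 h]
        exact Submodule.mem_span_singleton_self _
    · rw [Submodule.span_singleton_le_iff_mem]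
      exact hker.2 rfl
  have hratio : ∀ z ∈ Z, ∃ ρ : k, b z.rep = ρ • a z.rep := by
    intro z hz
    obtain ⟨s, t, hst, h⟩ := (inRankOneLocus_iff M z).1 (hZ z hz)
    have h' : s • a z.rep + t • b z.rep = 0 := funext h
    have ht : t ≠ 0 := by
      rintro rfl
      rw [zero_smul, add_zero] at h'
      have := (smul_eq_zero.1 h').resolve_left (hst.resolve_right (not_not.2 rfl))
      exact hyZ (hker.1 this ▸ hz)
    refine ⟨-(t⁻¹ * s), ?_⟩
    rw [neg_smul, mul_smul, eq_neg_of_add_eq_zero_left h', smul_neg, neg_neg, inv_smul_smul₀ ht]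
  obtain ⟨v, hv⟩ := exists_basis_of_nonDegenerate hnd
  have hl : ∀ i, ∃ ρ : k, b (v i) = ρ • a (v i) := by
    intro i
    obtain ⟨z, hz, hvz⟩ := hv i
    rw [hvz]
    exact hratio z hz
  choose l hl using hl
  have hiff {x ρ} := apply_eq_smul_apply_iff_mem_eigenSpace v a b hl hkera (x := x) (ρ := ρ)
  refine exists_kw_of_forall_mem_eigenSpace (l := l) v.equivFun hyZ rfl (fun z hz => ?_)
    fun ρ htop => ?_
  · obtain ⟨ρ, hρ⟩ := hratio z hz
    exact ⟨ρ, hiff.1 hρ⟩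
  · have hab (x) : b x = ρ • a x := hiff.2 (htop ▸ Submodule.mem_top)
    have hM' : (-ρ) • M 0 + (1 : k) • M 1 = 0 := by
      funext j
      refine LinearMap.ext fun x => ?_
      have := congrFun (hab x) j
      change -ρ * M 0 j x + 1 * M 1 j x = 0
      change M 1 j x = ρ * M 0 j x at this
      rw [this]
      ring
    rw [show M = ![M 0, M 1] from by funext i; fin_cases i <;> rfl,
      LinearIndependent.pair_iff] at hM
    exact one_ne_zero (hM _ _ hM').2

end PencilToVariety

section VarietyToPencil

variable {k : Type*} [Field k] {n : ℕ}

/-- The affine Veronese vector `(s^d, s^{d-1} t, …, t^d)`. -/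
def veronese (d : ℕ) (s t : k) : Fin (d + 1) → k := fun i => s ^ (d - (i : ℕ)) * t ^ (i : ℕ)

theorem smul_veronese_succ (d : ℕ) (s t : k) (i : Fin d) :
    s * veronese d s t i.succ = t * veronese d s t i.castSucc := by
  have h : d - (i : ℕ) = d - (i + 1) + 1 := by omega
  simp only [veronese, Fin.val_succ, Fin.val_castSucc]
  rw [h, pow_succ, pow_succ]
  ring

theorem veronese_one_zero (d : ℕ) (t : k) : veronese d 1 t 0 = 1 := by simp [veronese]

theorem eq_smul_veronese {d : ℕ} {t : k} {x : Fin (d + 1) → k}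
    (h : ∀ i : Fin d, x i.succ = t * x i.castSucc) : x = x 0 • veronese d 1 t := by
  funext i
  induction i using Fin.induction with
  | zero => simp [veronese]
  | succ i ih =>
    rw [h, ih]
    have := smul_veronese_succ d 1 t i
    rw [one_mul] at this
    rw [Pi.smul_apply, Pi.smul_apply, this, smul_eq_mul, smul_eq_mul]
    ring

section Pencil

variable {d s : ℕ} {V : Type*} [AddCommGroup V] [Module k V] (W : Fin s → Submodule k V)

/-- The map acting as the initial-segment map on the Kronecker block and as multiplication
by `u i` on the `i`-th diagonal block. -/
def initMap (u : Fin s → k) :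
    ((Fin (d + 1) → k) × (∀ i, W i)) →ₗ[k] ((Fin d → k) × (∀ i, W i)) :=
  (LinearMap.funLeft k k Fin.castSucc).prodMap
    (LinearMap.pi fun i => u i • LinearMap.proj i)

/-- The map acting as the final-segment map on the Kronecker block and as multiplication
by `u i` on the `i`-th diagonal block. -/
def tailMap (u : Fin s → k) :
    ((Fin (d + 1) → k) × (∀ i, W i)) →ₗ[k] ((Fin d → k) × (∀ i, W i)) :=
  (LinearMap.funLeft k k Fin.succ).prodMap
    (LinearMap.pi fun i => u i • LinearMap.proj i)

theorem initMap_apply (u : Fin s → k) (p : (Fin (d + 1) → k) × (∀ i, W i)) :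
    initMap W u p = (fun i => p.1 i.castSucc, fun i => u i • p.2 i) := rfl

theorem tailMap_apply (u : Fin s → k) (p : (Fin (d + 1) → k) × (∀ i, W i)) :
    tailMap W u p = (fun i => p.1 i.succ, fun i => u i • p.2 i) := rfl

/-- The sum map from the source of the model pencil to the ambient space. -/
def sumMap (A : (Fin (d + 1) → k) →ₗ[k] V) : ((Fin (d + 1) → k) × (∀ i, W i)) →ₗ[k] V :=
  A.coprod (∑ i, (W i).subtype ∘ₗ LinearMap.proj i)

theorem sumMap_inl (A : (Fin (d + 1) → k) →ₗ[k] V) (x : Fin (d + 1) → k) :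
    sumMap W A (x, 0) = A x := by
  simp [sumMap]

theorem sumMap_single (A : (Fin (d + 1) → k) →ₗ[k] V) (x : Fin (d + 1) → k) (i : Fin s)
    (w : W i) : sumMap W A (x, Pi.single i w) = A x + w := by
  simp only [sumMap, LinearMap.coprod_apply, LinearMap.sum_apply, LinearMap.comp_apply,
    LinearMap.proj_apply, Submodule.subtype_apply]
  rw [Finset.sum_eq_single i, Pi.single_eq_same]
  · intro j _ hj
    rw [Pi.single_eq_of_ne hj]
    rfl
  · simp

theorem eq_smul_of_pencil_eq {S T : Fin s → k} {t₀ : k} (ht₀ : ∀ i, T i ≠ t₀ * S i)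
    {p : (Fin (d + 1) → k) × (∀ i, W i)} (hp : t₀ • initMap W S p = tailMap W T p) :
    p = p.1 0 • (veronese d 1 t₀, 0) := by
  rw [initMap_apply, tailMap_apply] at hp
  obtain ⟨h1, h2⟩ := Prod.ext_iff.1 hp
  refine Prod.ext (eq_smul_veronese fun i => (congrFun h1 i).symm) ?_
  rw [Prod.smul_mk, smul_zero]
  funext i
  have : (t₀ * S i) • p.2 i = T i • p.2 i := by
    rw [mul_smul]
    exact congrFun h2 i
  rw [← sub_eq_zero, ← sub_smul] at this
  exact (smul_eq_zero.1 this).resolve_left (sub_ne_zero.2 (ht₀ i).symm)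

theorem pencil_independent {S T : Fin s → k} (hW : ∀ i, W i ≠ ⊥)
    (h : 1 ≤ d ∨ ∃ i j, S i * T j ≠ S j * T i) {α β : k}
    (hαβ : ∀ p : (Fin (d + 1) → k) × (∀ i, W i), α • initMap W S p + β • tailMap W T p = 0) :
    α = 0 ∧ β = 0 := by
  rcases h with h | ⟨i, j, hij⟩
  · obtain ⟨d, rfl⟩ := Nat.exists_eq_succ_of_ne_zero (Nat.one_le_iff_ne_zero.1 h)
    have h0 := congrFun (congrArg Prod.fst (hαβ (Pi.single 0 1, 0))) 0
    have h1 := congrFun (congrArg Prod.fst (hαβ (Pi.single (Fin.last _) 1, 0))) (Fin.last _)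
    constructor
    · simpa [initMap_apply, tailMap_apply] using h0
    · simpa [initMap_apply, tailMap_apply, Fin.castSucc_ne_last] using h1
  · have key (i) : α * S i + β * T i = 0 := by
      obtain ⟨w, hw, hw0⟩ := Submodule.exists_mem_ne_zero_of_ne_bot (hW i)
      have := congrFun (congrArg Prod.snd (hαβ (0, Pi.single i ⟨w, hw⟩))) i
      simp only [initMap_apply, tailMap_apply, Pi.single_eq_same, Prod.snd_add, Prod.smul_snd,
        Pi.add_apply, Pi.smul_apply, smul_smul, ← add_smul, Prod.snd_zero, Pi.zero_apply] at this
      exact (smul_eq_zero.1 this).resolve_right fun h => hw0 (congrArg Subtype.val h)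
    have hdet : S i * T j - S j * T i ≠ 0 := sub_ne_zero.2 hij
    constructor
    · refine (mul_eq_zero.1 (?_ : α * (S i * T j - S j * T i) = 0)).resolve_right hdet
      linear_combination T j * key i - T i * key j
    · refine (mul_eq_zero.1 (?_ : β * (S i * T j - S j * T i) = 0)).resolve_right hdet
      linear_combination S i * key j - S j * key i

end Pencil

theorem exists_submodule_sup_span_eq {V : Type*} [AddCommGroup V] [Module k V]
    [FiniteDimensional k V] {W : Submodule k V} {p : V} (hp : p ∈ W) (hp0 : p ≠ 0) :
    ∃ W' : Submodule k V, (∀ x ∈ W, ∃ r : k, ∃ w ∈ W', x = r • p + w) ∧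
      Module.finrank k W = Module.finrank k W' + 1 := by
  obtain ⟨Q, hQ⟩ := Submodule.exists_isCompl (Submodule.span k {p})
  have hle : Submodule.span k {p} ≤ W := (Submodule.span_singleton_le_iff_mem _ _).2 hp
  have hsup : Submodule.span k {p} ⊔ (Q ⊓ W) = W := by
    rw [← sup_inf_assoc_of_le _ hle, hQ.sup_eq_top, top_inf_eq]
  have hinf : Submodule.span k {p} ⊓ (Q ⊓ W) = ⊥ := by
    rw [← inf_assoc, hQ.inf_eq_bot, bot_inf_eq]
  refine ⟨Q ⊓ W, fun x hx => ?_, ?_⟩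
  · rw [← hsup] at hx
    obtain ⟨u, hu, w, hw, rfl⟩ := Submodule.mem_sup.1 hx
    obtain ⟨r, rfl⟩ := Submodule.mem_span_singleton.1 hu
    exact ⟨r, w, hw, rfl⟩
  · have := Submodule.finrank_sup_add_finrank_inf_eq (Submodule.span k {p}) (Q ⊓ W)
    rw [hsup, hinf, finrank_bot, finrank_span_singleton hp0] at this
    omega

theorem exists_pencil {Z : Set (Projectivization k (Fin (n + 1) → k))}
    (hnd : NonDegenerate k n Z) {d s : ℕ} (nn : Fin s → ℕ) (hnn : ∀ i, 1 ≤ nn i)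
    (hsum : d + ∑ i, nn i = n) (A : (Fin (d + 1) → k) →ₗ[k] (Fin (n + 1) → k))
    (W : Fin s → Submodule k (Fin (n + 1) → k))
    (hWfinrank : ∀ i, Module.finrank k (W i) = nn i + 1) (S T : Fin s → k) (t₀ : k)
    (hmem : ∀ i, A (veronese d (S i) (T i)) ∈ W i) (hne : ∀ i, A (veronese d (S i) (T i)) ≠ 0)
    (ht₀ : ∀ i, T i ≠ t₀ * S i)
    (hZ : ∀ z ∈ Z, (∃ σ τ r : k, (σ ≠ 0 ∨ τ ≠ 0) ∧ z.rep = r • A (veronese d σ τ)) ∨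
      ∃ i, z.rep ∈ W i)
    (hy : ∀ z ∈ Z, z.rep ∉ Submodule.span k {A (veronese d 1 t₀)})
    (hindep : 1 ≤ d ∨ ∃ i j, S i * T j ≠ S j * T i) :
    ∃ y ∉ Z, ∃ M : Fin 2 → Fin n → Module.Dual k (Fin (n + 1) → k),
      LinearIndependent k M ∧ RowDefinesPoint k n (M 0) y ∧ ∀ z ∈ Z, InRankOneLocus k n M z := by
  choose W' hW' hWW' using fun i => exists_submodule_sup_span_eq (hmem i) (hne i)
  have hW'finrank (i) : Module.finrank k (W' i) = nn i := by
    have := hWW' i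
    rw [hWfinrank] at this
    omega
  have hW'bot (i) : W' i ≠ ⊥ := by
    intro h
    have h1 := hW'finrank i
    rw [h, finrank_bot] at h1
    exact absurd (hnn i) (by omega)
  -- every point of `Z` lifts to a vector on which the two maps of the model pencil are dependent
  have hlift : ∀ z ∈ Z, ∃ p, sumMap W' A p = z.rep ∧ ∃ σ τ : k, (σ ≠ 0 ∨ τ ≠ 0) ∧
      σ • tailMap W' T p = τ • initMap W' S p := by
    intro z hz
    rcases hZ z hz with ⟨σ, τ, r, hστ, hr⟩ | ⟨i, hi⟩
    · refine ⟨(r • veronese d σ τ, 0), by rw [sumMap_inl, map_smul, hr], σ, τ, hστ, ?_⟩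
      rw [tailMap_apply, initMap_apply]
      refine Prod.ext (funext fun j => ?_) (funext fun j => ?_)
      · have := smul_veronese_succ d σ τ j
        simp only [Prod.smul_mk, Pi.smul_apply, smul_eq_mul]
        linear_combination r * this
      · simp
    · obtain ⟨r, w, hw, hx⟩ := hW' i _ hi
      refine ⟨(r • veronese d (S i) (T i), Pi.single i ⟨w, hw⟩),
        by rw [sumMap_single, map_smul, hx], S i, T i, ?_, ?_⟩
      · by_contra! h
        exact ht₀ i (by rw [h.1, h.2, mul_zero])
      · rw [tailMap_apply, initMap_apply]
        refine Prod.ext (funext fun j => ?_) (funext fun j => ?_)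
        · have := smul_veronese_succ d (S i) (T i) j
          simp only [Prod.smul_mk, Pi.smul_apply, smul_eq_mul]
          linear_combination r * this
        · rcases eq_or_ne j i with rfl | hji
          · simp only [Prod.smul_mk, Pi.smul_apply, smul_smul, mul_comm]
          · simp [Pi.single_eq_of_ne hji]
  have hsurj : Function.Surjective (sumMap W' A) := by
    rw [← LinearMap.range_eq_top, eq_top_iff, ← span_rep_eq_top hnd, Submodule.span_le]
    rintro _ ⟨z, hz, rfl⟩
    obtain ⟨p, hp, -⟩ := hlift z hz
    exact ⟨p, hp⟩
  have hpi : Module.finrank k (∀ i, W' i) = ∑ i, nn i := by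
    rw [Module.finrank_pi_fintype]
    exact Finset.sum_congr rfl fun i _ => hW'finrank i
  have hdim : Module.finrank k ((Fin (d + 1) → k) × (∀ i, W' i)) =
      Module.finrank k (Fin (n + 1) → k) := by
    rw [Module.finrank_prod, hpi, Module.finrank_fin_fun, Module.finrank_fin_fun]
    omega
  have hdim' : Module.finrank k ((Fin d → k) × (∀ i, W' i)) = Module.finrank k (Fin n → k) := by
    rw [Module.finrank_prod, hpi, Module.finrank_fin_fun, Module.finrank_fin_fun]
    omega
  let Φ := LinearEquiv.ofBijective (sumMap W' A)
    ⟨(LinearMap.injective_iff_surjective_of_finrank_eq_finrank hdim).2 hsurj, hsurj⟩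
  let ψ := LinearEquiv.ofFinrankEq _ _ hdim'
  let a : (Fin (n + 1) → k) →ₗ[k] (Fin n → k) := ψ.toLinearMap ∘ₗ
    (t₀ • initMap W' S - tailMap W' T) ∘ₗ Φ.symm.toLinearMap
  let b : (Fin (n + 1) → k) →ₗ[k] (Fin n → k) := ψ.toLinearMap ∘ₗ
    initMap W' S ∘ₗ Φ.symm.toLinearMap
  have ha (x) : a x = ψ (t₀ • initMap W' S (Φ.symm x) - tailMap W' T (Φ.symm x)) := rfl
  have hb (x) : b x = ψ (initMap W' S (Φ.symm x)) := rfl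
  have hΦ (x) : Φ (x, 0) = A x := sumMap_inl W' A x
  have hy0 : A (veronese d 1 t₀) ≠ 0 := by
    rw [← hΦ, Φ.map_ne_zero_iff]
    intro h
    exact one_ne_zero ((veronese_one_zero d t₀).symm.trans (congrFun (congrArg Prod.fst h) 0))
  have hker : LinearMap.ker a = Submodule.span k {A (veronese d 1 t₀)} := by
    ext x
    rw [LinearMap.mem_ker, ha, ψ.map_eq_zero_iff, sub_eq_zero, Submodule.mem_span_singleton]
    constructor
    · intro h
      refine ⟨(Φ.symm x).1 0, ?_⟩
      rw [← hΦ, ← map_smul, ← eq_smul_of_pencil_eq W' ht₀ h, Φ.apply_symm_apply]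
    · rintro ⟨r, rfl⟩
      rw [← hΦ, ← Φ.map_smul, Φ.symm_apply_apply, (initMap W' S).map_smul,
        (tailMap W' T).map_smul, smul_comm, initMap_apply, tailMap_apply]
      congr 1
      refine Prod.ext (funext fun j => ?_) (funext fun j => ?_)
      · simpa using (smul_veronese_succ d 1 t₀ j).symm
      · simp
  have hasurj : LinearMap.range a = ⊤ := by
    refine Submodule.eq_top_of_finrank_eq ?_
    have := LinearMap.finrank_range_add_finrank_ker a
    rw [hker, finrank_span_singleton hy0, Module.finrank_fin_fun] at this
    rw [Module.finrank_fin_fun]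
    omega
  let M : Fin 2 → Fin n → Module.Dual k (Fin (n + 1) → k) :=
    ![fun j => LinearMap.proj j ∘ₗ a, fun j => LinearMap.proj j ∘ₗ b]
  refine ⟨Projectivization.mk k _ hy0, fun h => hy _ h ((eq_mk_iff_rep_mem_span hy0).1 rfl), M,
    ?_, ⟨?_, ?_⟩, fun z hz => ?_⟩
  · rw [LinearIndependent.pair_iff]
    intro σ τ h
    have hab (x) : σ • a x + τ • b x = 0 := funext fun j =>
      LinearMap.congr_fun (congrFun h j) x
    have := pencil_independent W' (α := σ * t₀ + τ) (β := -σ) hW'bot hindep fun p => by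
      have := hab (Φ p)
      rw [ha, hb, Φ.symm_apply_apply, ← ψ.map_smul, ← ψ.map_smul, ← ψ.map_add,
        ψ.map_eq_zero_iff] at this
      rw [← this]
      module
    have hσ : σ = 0 := neg_eq_zero.1 this.2
    refine ⟨hσ, ?_⟩
    have h1 := this.1
    rwa [hσ, zero_mul, zero_add] at h1
  · rw [Fintype.linearIndependent_iff]
    intro g hg i
    obtain ⟨x, hx⟩ := LinearMap.range_eq_top.1 hasurj (Pi.single i 1)
    have := LinearMap.congr_fun hg x
    simpa [M, hx, Pi.single_apply] using this
  · ext x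
    rw [Set.mem_singleton_iff, eq_mk_iff_rep_mem_span, ← hker, LinearMap.mem_ker, funext_iff]
    rfl
  · obtain ⟨p, hp, σ, τ, hστ, h⟩ := hlift z hz
    have hp' : Φ.symm z.rep = p := by
      rw [← hp]
      exact Φ.symm_apply_apply p
    refine (inRankOneLocus_iff M z).2 ⟨σ, τ - σ * t₀, ?_, fun j => ?_⟩
    · by_contra! h'
      obtain ⟨h1, h2⟩ := h'
      rw [h1, zero_mul, sub_zero] at h2
      exact hστ.elim (· h1) (· h2)
    · have h0 : σ • a z.rep + (τ - σ * t₀) • b z.rep = 0 := by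
        rw [ha, hb, hp', ← ψ.map_smul, ← ψ.map_smul, ← ψ.map_add, ψ.map_eq_zero_iff, smul_sub, h]
        module
      exact congrFun h0 j

theorem subsingleton_setOf_rep_mem_span_veronese {d : ℕ} (hd : 1 ≤ d)
    {A : (Fin (d + 1) → k) →ₗ[k] (Fin (n + 1) → k)} (hA : Function.Injective A)
    (z : Projectivization k (Fin (n + 1) → k)) :
    {t : k | z.rep ∈ Submodule.span k {A (veronese d 1 t)}}.Subsingleton := by
  intro t ht t' ht'
  obtain ⟨r, hr⟩ := Submodule.mem_span_singleton.1 ht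
  obtain ⟨r', hr'⟩ := Submodule.mem_span_singleton.1 ht'
  have h : r • veronese d 1 t = r' • veronese d 1 t' :=
    hA (by rw [map_smul, map_smul, hr, hr'])
  have hr0 : r ≠ 0 := by
    rintro rfl
    exact z.rep_nonzero (by rw [← hr, zero_smul])
  have h0 := congrFun h 0
  have h1 := congrFun h ⟨1, by omega⟩
  simp only [veronese, Pi.smul_apply, smul_eq_mul, Fin.val_zero, pow_zero, one_pow, mul_one,
    pow_one, one_mul] at h0 h1
  rw [← h0] at h1
  exact mul_left_cancel₀ hr0 h1

theorem veronese_ne_zero_imp {d : ℕ} (hd : 1 ≤ d) {s t : k} (h : veronese d s t ≠ 0) :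
    s ≠ 0 ∨ t ≠ 0 := by
  by_contra! h'
  refine h (funext fun i => ?_)
  obtain ⟨rfl, rfl⟩ := h'
  rcases Nat.eq_zero_or_pos (i : ℕ) with hi | hi
  · simp [veronese, hi, zero_pow (Nat.one_le_iff_ne_zero.1 hd)]
  · simp [veronese, zero_pow hi.ne']

theorem exists_pencil_of_isKWpos [Infinite k] {Z : Set (Projectivization k (Fin (n + 1) → k))}
    (hfin : Z.Finite) (hnd : NonDegenerate k n Z) {d s : ℕ}
    {Y C : Set (Projectivization k (Fin (n + 1) → k))} (hZY : Z ⊆ Y) (hY : IsKWpos k n d s Y C) :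
    ∃ y ∉ Z, ∃ M : Fin 2 → Fin n → Module.Dual k (Fin (n + 1) → k),
      LinearIndependent k M ∧ RowDefinesPoint k n (M 0) y ∧ ∀ z ∈ Z, InRankOneLocus k n M z := by
  obtain ⟨hd, nn, L, W, hnn, hsum, ⟨A, hA, -, rfl⟩, hfinrank, hp, -, rfl⟩ := hY
  choose p hpC hp using hp
  choose S T c hc hpST using hpC
  change ∀ i, c i • (p i).rep = A (veronese d (S i) (T i)) at hpST
  have hST {σ τ r : k} {x : Projectivization k (Fin (n + 1) → k)} (hr : r ≠ 0)
      (h : r • x.rep = A (veronese d σ τ)) : σ ≠ 0 ∨ τ ≠ 0 := by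
    refine veronese_ne_zero_imp hd fun h0 => ?_
    rw [h0, map_zero] at h
    exact (smul_ne_zero hr x.rep_nonzero) h
  have hbad : ((⋃ i, {t : k | T i = t * S i}) ∪
      ⋃ z ∈ Z, {t : k | z.rep ∈ Submodule.span k {A (veronese d 1 t)}}).Finite := by
    refine (Set.finite_iUnion fun i => Set.Subsingleton.finite fun t ht t' ht' => ?_).union
      (hfin.biUnion fun z _ => (subsingleton_setOf_rep_mem_span_veronese hd hA z).finite)
    have h1 : T i = t * S i := ht
    have h2 : T i = t' * S i := ht'
    have hS : S i ≠ 0 := by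
      intro h
      rw [h, mul_zero] at h1
      exact (hST (hc i) (hpST i)).elim (· h) (· h1)
    exact mul_right_cancel₀ hS (h1.symm.trans h2)
  obtain ⟨t₀, ht₀⟩ := hbad.exists_notMem
  simp only [Set.mem_union, Set.mem_iUnion, Set.mem_ofPred_eq, not_or, not_exists] at ht₀
  refine exists_pencil hnd nn (fun i => (hnn i).1) hsum A W hfinrank S T t₀ (fun i => ?_)
    (fun i => ?_) ht₀.1 (fun z hz => ?_) ht₀.2 (Or.inl hd)
  · rw [← hpST]
    have : p i ∈ projSet k L ∩ projSet k (W i) := hp i ▸ rfl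
    exact (W i).smul_mem _ this.2
  · rw [← hpST]
    exact smul_ne_zero (hc i) (p i).rep_nonzero
  · rcases hZY hz with ⟨σ, τ, r, hr, h⟩ | h
    · exact Or.inl ⟨σ, τ, r⁻¹, hST hr h, (eq_inv_smul_iff₀ hr).2 h⟩
    · exact Or.inr (Set.mem_iUnion.1 h :)

theorem exists_pencil_of_isKW0 [Infinite k] (hn : 2 ≤ n)
    {Z : Set (Projectivization k (Fin (n + 1) → k))} (hnd : NonDegenerate k n Z) {s : ℕ}
    {Y : Set (Projectivization k (Fin (n + 1) → k))} (hZY : Z ⊆ Y)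
    {y : Projectivization k (Fin (n + 1) → k)} (hY : IsKW0 k n s Y y) (hyZ : y ∉ Z) :
    ∃ y ∉ Z, ∃ M : Fin 2 → Fin n → Module.Dual k (Fin (n + 1) → k),
      LinearIndependent k M ∧ RowDefinesPoint k n (M 0) y ∧ ∀ z ∈ Z, InRankOneLocus k n M z := by
  obtain ⟨nn, W, hnn, hsum, hfinrank, hyW, -, rfl⟩ := hY
  let A : (Fin (0 + 1) → k) →ₗ[k] (Fin (n + 1) → k) :=
    (LinearMap.proj 0).smulRight y.rep
  have hA (t : k) : A (veronese 0 1 t) = y.rep := by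
    simp [A, veronese_one_zero]
  let f : Fin s ↪ k := Fin.valEmbedding.trans (Infinite.natEmbedding k)
  obtain ⟨t₀, ht₀⟩ := (Set.finite_range f).exists_notMem
  refine exists_pencil hnd nn (fun i => (hnn i).1) (by rwa [zero_add]) A W hfinrank (fun _ => 1) f
    t₀ (fun i => by rw [hA]; exact hyW i) (fun i => by rw [hA]; exact y.rep_nonzero)
    (fun i h => ht₀ ⟨i, by rw [h, mul_one]⟩) (fun z hz => Or.inr (Set.mem_iUnion.1 (hZY hz) :))
    (fun z hz h => ?_) (Or.inr ?_)
  · rw [hA] at h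
    exact hyZ (eq_of_rep_mem_span_rep h ▸ hz)
  · have hs : 2 ≤ s := by
      by_contra! hs
      interval_cases s
      · simp at hsum
        omega
      · have := (hnn 0).2
        rw [Fin.sum_univ_one] at hsum
        omega
    refine ⟨⟨0, by omega⟩, ⟨1, by omega⟩, ?_⟩
    rw [one_mul, one_mul, f.injective.ne_iff]
    simp

end VarietyToPencil

end KW

/-- Main Theorem. Let `n ≥ 2` and let `Z ⊂ ℙ_n` be a finite
non-degenerate set of points. The following are equivalent:
(a) there exist a point `y ∈ ℙ_n \ Z` and a `2 × n` matrix `M` of linear forms on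
`ℙ_n` with non-proportional (i.e. linearly independent) rows, whose first row
defines `y`, such that `Z` is contained in the rank-1 locus of `M`;
(b) `Z` is contained in a Kronecker–Weierstrass variety `Y ⊆ ℙ_n` of some type
`(d;s)`, such that if `d = 0` the distinguished point of `Y` does not lie in `Z`. -/
theorem statement0 (k : Type*) [Field k] [IsAlgClosed k] (n : ℕ) (hn : 2 ≤ n)
    (Z : Set (Projectivization k (Fin (n + 1) → k))) (hfin : Z.Finite)
    (hnd : NonDegenerate k n Z) :
    (∃ y ∉ Z, ∃ M : Fin 2 → Fin n → Module.Dual k (Fin (n + 1) → k),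
        LinearIndependent k M ∧ RowDefinesPoint k n (M 0) y ∧
        ∀ z ∈ Z, InRankOneLocus k n M z) ↔
    (∃ (d s : ℕ) (Y : Set (Projectivization k (Fin (n + 1) → k))), Z ⊆ Y ∧
        ((∃ C, IsKWpos k n d s Y C) ∨
          (d = 0 ∧ ∃ y, IsKW0 k n s Y y ∧ y ∉ Z))) := by
  have : Infinite k := IsAlgClosed.instInfinite
  constructor
  · rintro ⟨y, hyZ, M, hM, hy, hZ⟩
    exact KW.exists_kw_of_pencil hnd hyZ hM hy hZ
  · rintro ⟨d, s, Y, hZY, ⟨C, hY⟩ | ⟨-, y, hY, hyZ⟩⟩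
    · exact KW.exists_pencil_of_isKWpos hfin hnd hZY hY
    · exact KW.exists_pencil_of_isKW0 hn hnd hZY hY hyZ
end
end

section
/- Let n ≥ 2, let Z ⊂ ℙ_n be a finite non-degenerate set of points, and let y ∈ ℙ_n be a point not in Z. Then there exists a 2×n matrix M of linear forms on ℙ_n with non-proportional rows whose first row defines y and whose rank-1 locus contains Z, if and only if Z is contained in a Kronecker–Weierstrass variety Y of some type (d;s) with either d > 0 and y lying on the rational normal curve part of Y, or d = 0 and y equal to the distinguished point of Y. -/
noncomputable section

open scoped BigOperators

/-- A vector satisfying the recursion `t u_i = s u_{i+1}` lies on the cone over the rational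
normal curve. -/
theorem exists_eq_smul_veronese {k : Type*} [Field k] {d : ℕ} {s t : k} (hst : s ≠ 0 ∨ t ≠ 0)
    (u : Fin (d + 1) → k) (hu : ∀ i : Fin d, t * u i.castSucc = s * u i.succ) :
    ∃ c : k, u = c • fun i : Fin (d + 1) => s ^ (d - (i : ℕ)) * t ^ (i : ℕ) := by
  by_cases hs : s = 0
  · subst hs
    have ht : t ≠ 0 := by simpa using hst
    refine ⟨u (Fin.last d) / t ^ d, ?_⟩
    ext i
    induction i using Fin.lastCases with
    | last => simp [ht]
    | cast i =>
      have h := hu i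
      have h' : d - (i : ℕ) ≠ 0 := by omega
      simp_all
  · have key : ∀ i : Fin (d + 1), s ^ (i : ℕ) * u i = t ^ (i : ℕ) * u 0 := by
      intro i
      induction i using Fin.induction with
      | zero => simp
      | succ i ih =>
        have h := hu i
        simp only [Fin.val_castSucc, Fin.val_succ] at ih ⊢
        linear_combination (-s ^ (i : ℕ)) * h + t * ih
    refine ⟨u 0 / s ^ d, ?_⟩
    ext i
    have hd : s ^ d = s ^ (d - (i : ℕ)) * s ^ (i : ℕ) := by
      rw [← pow_add]; congr 1; omega
    simp only [Pi.smul_apply, smul_eq_mul]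
    rw [div_mul_eq_mul_div, eq_div_iff (pow_ne_zero _ hs), hd]
    linear_combination s ^ (d - (i : ℕ)) * key i

/-- The vectors `(s^d, …, t^d)` satisfy the recursion `t u_i = s u_{i+1}`, both sides being the
corresponding vector of degree `d - 1` up to the factors `s` and `t`. -/
theorem veronese_castSucc_succ {k : Type*} [Field k] {d : ℕ} (s t : k) (i : Fin d) :
    s ^ (d - (i.castSucc : ℕ)) * t ^ (i.castSucc : ℕ) = s * (s ^ (d - 1 - i : ℕ) * t ^ (i : ℕ)) ∧
      s ^ (d - (i.succ : ℕ)) * t ^ (i.succ : ℕ) = t * (s ^ (d - 1 - i : ℕ) * t ^ (i : ℕ)) := by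
  have h1 : d - (i : ℕ) = (d - 1 - i) + 1 := by omega
  have h2 : d - ((i : ℕ) + 1) = d - 1 - i := by omega
  simp only [Fin.val_castSucc, Fin.val_succ, h2]
  rw [h1]
  constructor <;> ring

/-- The iterates `divX^[i] p` have the shifted coefficients of `p`. -/
theorem coeff_iterate_divX {R : Type*} [Semiring R] (p : Polynomial R) (i m : ℕ) :
    (Polynomial.divX^[i] p).coeff m = p.coeff (m + i) := by
  induction i generalizing m with
  | zero => rfl
  | succ i ih => rw [Function.iterate_succ_apply', Polynomial.coeff_divX, ih, add_right_comm,
      add_assoc]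

/-- A nonzero vector of a finite-dimensional space with an endomorphism has a monic annihilating
polynomial of minimal degree. -/
theorem exists_monic_minimal_annihilator {k V : Type*} [Field k] [AddCommGroup V] [Module k V]
    [FiniteDimensional k V] (D : V →ₗ[k] V) {y : V} (hy : y ≠ 0) :
    ∃ (d : ℕ) (q : Polynomial k), q.Monic ∧ q.natDegree = d + 1 ∧
      Polynomial.aeval D q y = 0 ∧
      ∀ p : Polynomial k, p.natDegree ≤ d → Polynomial.aeval D p y = 0 → p = 0 := by
  classical
  have hex : ∃ m : ℕ, ∃ p : Polynomial k, p.Monic ∧ p.natDegree = m ∧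
      Polynomial.aeval D p y = 0 :=
    ⟨_, minpoly k D, minpoly.monic (Algebra.IsIntegral.isIntegral D), rfl, by
      simp [minpoly.aeval]⟩
  obtain ⟨q, hq, hdeg, hqy⟩ := Nat.find_spec hex
  have hmin : ∀ m < Nat.find hex, _ := fun m hm => Nat.find_min hex hm
  generalize Nat.find hex = m at hdeg hmin
  obtain _ | d := m
  · rw [hq.natDegree_eq_zero.mp hdeg] at hqy
    simp [hy] at hqy
  · refine ⟨d, q, hq, hdeg, hqy, fun p hp hpy => ?_⟩
    by_contra hp0
    refine hmin p.natDegree (by omega) ⟨p * Polynomial.C p.leadingCoeff⁻¹,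
      Polynomial.monic_mul_leadingCoeff_inv hp0,
      Polynomial.natDegree_mul_leadingCoeff_inv _ hp0, ?_⟩
    rw [mul_comm, map_mul]
    simp [hpy]

/-- A Kronecker chain starting from the kernel vector `y` of `π`: the restriction of the pencil
`(π, π ∘ D)` to the `D`-cyclic subspace generated by `y` is the standard pencil of two shifts. -/
theorem exists_kronecker_chain {k V E : Type*} [Field k] [AddCommGroup V] [Module k V]
    [FiniteDimensional k V] [AddCommGroup E] [Module k E] (π : V →ₗ[k] E) (D : V →ₗ[k] V)
    {y : V} (hy : y ≠ 0) (hker : LinearMap.ker π = Submodule.span k {y}) :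
    ∃ (d : ℕ) (A : (Fin (d + 1) → k) →ₗ[k] V) (B : (Fin d → k) →ₗ[k] E),
      Function.Injective A ∧ Function.Injective B ∧ A (Pi.single (Fin.last d) 1) = y ∧
      (∀ u, π (A u) = B fun i => u i.castSucc) ∧
      (∀ u, π (D (A u)) = B fun i => u i.succ) := by
  classical
  obtain ⟨d, q, hq, hdeg, hqy, hmin⟩ := exists_monic_minimal_annihilator D hy
  set h : ℕ → Polynomial k := fun i => Polynomial.divX^[i] q with hh
  have hcoeff : ∀ i m, (h i).coeff m = q.coeff (m + i) := fun i m => coeff_iterate_divX q i m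
  have hstep : ∀ i, h (i + 1) * Polynomial.X + Polynomial.C (q.coeff i) = h i := by
    intro i
    have := Polynomial.divX_mul_X_add (h i)
    rw [hcoeff, zero_add] at this
    have hsucc : h (i + 1) = (h i).divX := Function.iterate_succ_apply' _ _ _
    rwa [hsucc]
  set a : ℕ → V := fun i => Polynomial.aeval D (h (i + 1)) y with ha
  have hπy : π y = 0 := by
    rw [← LinearMap.mem_ker, hker]; exact Submodule.mem_span_singleton_self y
  have hDa : ∀ i, π (D (a i)) = π (Polynomial.aeval D (h i) y) := by
    intro i
    rw [← hstep i, mul_comm]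
    simp [ha, Module.algebraMap_end_apply, hπy]
  set A : (Fin (d + 1) → k) →ₗ[k] V := Fintype.linearCombination k fun i : Fin (d + 1) => a i
    with hA
  have hAu : ∀ u, A u = ∑ i, u i • a i := fun u => Fintype.linearCombination_apply k _ u
  have hAinj : Function.Injective A := by
    rw [injective_iff_map_eq_zero]
    intro u hu
    have hp : (∑ i : Fin (d + 1), u i • h (i + 1)) = 0 := by
      apply hmin
      · refine Polynomial.natDegree_sum_le_of_forall_le _ _ fun i _ => ?_
        refine (Polynomial.natDegree_smul_le _ _).trans ?_
        rw [Polynomial.natDegree_le_iff_coeff_eq_zero]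
        intro N hN
        rw [hcoeff]
        exact Polynomial.coeff_eq_zero_of_natDegree_lt (by omega)
      · rw [hAu] at hu
        simpa [ha, LinearMap.sum_apply] using hu
    have key : ∀ N : ℕ, ∀ i : Fin (d + 1), (i : ℕ) = N → u i = 0 := by
      intro N
      induction N using Nat.strong_induction_on with
      | _ N ih =>
        intro i hi
        have hc := congrArg (fun p => Polynomial.coeff p (d - i)) hp
        simp only [Polynomial.finsetSum_coeff, Polynomial.coeff_smul, hcoeff,
          Polynomial.coeff_zero, smul_eq_mul] at hc
        rw [Finset.sum_eq_single i] at hc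
        · have : d - (i : ℕ) + (i + 1) = q.natDegree := by omega
          rw [this, Polynomial.coeff_natDegree, hq.leadingCoeff, mul_one] at hc
          exact hc
        · intro j _ hj
          rcases lt_or_gt_of_ne (Fin.val_ne_of_ne hj) with hlt | hlt
          · rw [ih j (by omega) j rfl, zero_mul]
          · rw [Polynomial.coeff_eq_zero_of_natDegree_lt (by omega), mul_zero]
        · simp
    ext i
    exact key i i rfl
  have hlast : a d = y := by
    have : h (d + 1) = 1 := by
      ext m
      rw [hcoeff, Polynomial.coeff_one]
      rcases Nat.eq_zero_or_pos m with rfl | hm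
      · rw [zero_add, ← hdeg, Polynomial.coeff_natDegree, hq.leadingCoeff, if_pos rfl]
      · rw [Polynomial.coeff_eq_zero_of_natDegree_lt (by omega), if_neg (by omega)]
    simp [ha, this]
  have hAlast : A (Pi.single (Fin.last d) 1) = y := by
    rw [hA, Fintype.linearCombination_apply_single, one_smul]
    exact hlast
  set B : (Fin d → k) →ₗ[k] E := Fintype.linearCombination k fun i : Fin d => π (a i) with hB
  have hBu : ∀ u, B u = ∑ i, u i • π (a i) := fun u => Fintype.linearCombination_apply k _ u
  have hπA : ∀ u, π (A u) = B fun i => u i.castSucc := by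
    intro u
    rw [hAu, hBu, Fin.sum_univ_castSucc]
    simp [hlast, hπy]
  refine ⟨d, A, B, hAinj, ?_, hAlast, hπA, ?_⟩
  · rw [injective_iff_map_eq_zero]
    intro u hu
    have h1 : π (A (Fin.snoc u 0)) = 0 := by rw [hπA]; simpa using hu
    rw [← LinearMap.mem_ker, hker, Submodule.mem_span_singleton] at h1
    obtain ⟨c, hc⟩ := h1
    rw [← hAlast, ← map_smul] at hc
    ext i
    have := congrFun (hAinj hc) i.castSucc
    simpa [Fin.castSucc_ne_last] using this.symm
  · intro u
    rw [hAu, hBu, Fin.sum_univ_succ]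
    have h0 : h 0 = q := rfl
    simp [hDa, h0, hqy]
    simp [ha]

/-- If subspaces of the eigenspaces of an endomorphism span the whole space, then only finitely
many of them are nonzero, and their dimensions add up to the dimension of the space. -/
theorem exists_finset_sum_finrank_eq_of_le_eigenspace {k U : Type*} [Field k] [AddCommGroup U]
    [Module k U] [FiniteDimensional k U] (D : Module.End k U) (F : k → Submodule k U)
    (hF : ∀ μ, F μ ≤ D.eigenspace μ) (htop : ⨆ μ, F μ = ⊤) :
    ∃ T : Finset k, (∀ μ, μ ∈ T ↔ F μ ≠ ⊥) ∧
      ∑ μ ∈ T, Module.finrank k (F μ) = Module.finrank k U := by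
  classical
  have hind : iSupIndep F := (Module.End.eigenspaces_iSupIndep D).mono hF
  have hfin : {μ | F μ ≠ ⊥}.Finite := WellFoundedGT.finite_ne_bot_of_iSupIndep hind
  refine ⟨hfin.toFinset, fun μ => by simp, ?_⟩
  have h_internal : DirectSum.IsInternal fun μ : hfin.toFinset => F μ := by
    rw [DirectSum.isInternal_submodule_iff_iSupIndep_and_iSup_eq_top]
    refine ⟨hind.comp Subtype.val_injective, ?_⟩
    rw [eq_top_iff, ← htop]
    refine iSup_le fun μ => ?_
    by_cases hμ : F μ = ⊥
    · simp [hμ]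
    · exact le_iSup (fun μ : hfin.toFinset => F μ) ⟨μ, by simpa using hμ⟩
  rw [← (LinearEquiv.ofBijective (DirectSum.coeLinearMap fun μ : hfin.toFinset => F μ)
    h_internal).finrank_eq, Module.finrank_directSum,
    ← Finset.sum_coe_sort]

/-- Decomposition of the rank-one locus of the pencil `(π, π ∘ D)`, where `π` has
one-dimensional kernel: a rational normal curve with span `range A`, together with finitely many
subspaces `ker (π ∘ D - μ π)`. -/
theorem exists_kronecker_decomposition {k V E : Type*} [Field k] [AddCommGroup V] [Module k V]
    [FiniteDimensional k V] [AddCommGroup E] [Module k E] (π : V →ₗ[k] E) (D : V →ₗ[k] V)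
    {y : V} (hy : y ≠ 0) (hker : LinearMap.ker π = Submodule.span k {y}) (Z : Set V)
    (hspan : Submodule.span k Z = ⊤) (hZ : ∀ z ∈ Z, ∃ μ : k, π (D z) = μ • π z) :
    ∃ (d : ℕ) (A : (Fin (d + 1) → k) →ₗ[k] V) (T : Finset k),
      Function.Injective A ∧ A (Pi.single (Fin.last d) 1) = y ∧ (π (D y) = 0 ↔ d = 0) ∧
      (∀ μ ∈ T, 2 ≤ Module.finrank k (LinearMap.ker (π ∘ₗ D - μ • π))) ∧
      (∀ μ ∉ T, LinearMap.ker (π ∘ₗ D - μ • π) ≤ LinearMap.range A) ∧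
      (d + ∑ μ ∈ T, (Module.finrank k (LinearMap.ker (π ∘ₗ D - μ • π)) - 1) + 1 =
        Module.finrank k V) ∧
      ∀ μ, LinearMap.range A ⊓ LinearMap.ker (π ∘ₗ D - μ • π) =
        Submodule.span k {A fun i => (1 : k) ^ (d - (i : ℕ)) * μ ^ (i : ℕ)} := by
  classical
  obtain ⟨d, A, B, hA, hB, hAy, hπA, hDA⟩ := exists_kronecker_chain π D hy hker
  set W : k → Submodule k V := fun μ => LinearMap.ker (π ∘ₗ D - μ • π) with hW
  have hWmem : ∀ μ x, x ∈ W μ ↔ π (D x) = μ • π x := by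
    intro μ x
    simp [hW, sub_eq_zero]
  set L := LinearMap.range A with hL
  have hyL : y ∈ L := ⟨_, hAy⟩
  have hkerL : ∀ x, π x = 0 → x ∈ L := by
    intro x hx
    rw [← LinearMap.mem_ker, hker] at hx
    exact (Submodule.span_singleton_le_iff_mem _ _).mpr hyL hx
  have hinf : ∀ μ, L ⊓ W μ =
      Submodule.span k {A fun i => (1 : k) ^ (d - (i : ℕ)) * μ ^ (i : ℕ)} := by
    intro μ
    apply le_antisymm
    · rintro _ ⟨⟨u, rfl⟩, hu⟩
      rw [SetLike.mem_coe, hWmem, hπA, hDA, ← map_smul] at hu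
      obtain ⟨c, hc⟩ := exists_eq_smul_veronese (s := 1) (t := μ) (Or.inl one_ne_zero) u
        fun i => by simpa using (congrFun (hB hu) i).symm
      rw [hc, map_smul]
      exact Submodule.smul_mem _ _ (Submodule.mem_span_singleton_self _)
    · rw [Submodule.span_singleton_le_iff_mem]
      refine ⟨⟨_, rfl⟩, ?_⟩
      rw [SetLike.mem_coe, hWmem, hπA, hDA, ← map_smul]
      congr 1
      ext i
      have h := veronese_castSucc_succ (1 : k) μ i
      simp only [Pi.smul_apply, smul_eq_mul]
      rw [h.1, h.2, one_mul]
  have hDL : L ≤ L.comap D := by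
    rintro _ ⟨u, rfl⟩
    have h : π (D (A u) - A (Fin.snoc (fun i : Fin d => u i.succ) 0)) = 0 := by
      rw [map_sub, hDA, hπA, sub_eq_zero]
      congr 1
      ext i
      simp
    have := L.add_mem (hkerL _ h) ⟨Fin.snoc (fun i : Fin d => u i.succ) 0, rfl⟩
    simpa using this
  have hsup : ⨆ μ, (W μ).map L.mkQ = ⊤ := by
    rw [← Submodule.map_iSup]
    have : ⨆ μ, W μ = ⊤ := by
      rw [eq_top_iff, ← hspan, Submodule.span_le]
      intro z hz
      obtain ⟨μ, hμ⟩ := hZ z hz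
      exact (le_iSup W μ) ((hWmem _ _).mpr hμ)
    rw [this, Submodule.map_top, Submodule.range_mkQ]
  obtain ⟨T, hT, hsum⟩ := exists_finset_sum_finrank_eq_of_le_eigenspace (L.mapQ L D hDL)
    (fun μ => (W μ).map L.mkQ) (by
      rintro μ _ ⟨x, hx, rfl⟩
      rw [Module.End.mem_eigenspace_iff]
      rw [SetLike.mem_coe, hWmem] at hx
      rw [Submodule.mkQ_apply, Submodule.mapQ_apply, ← Submodule.Quotient.mk_smul,
        Submodule.Quotient.eq]
      apply hkerL
      rw [map_sub, hx, map_smul, sub_self]) hsup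
  have hne : ∀ μ, (A fun i => (1 : k) ^ (d - (i : ℕ)) * μ ^ (i : ℕ)) ≠ 0 := by
    intro μ h
    rw [map_eq_zero_iff A hA] at h
    simpa using congrFun h 0
  have hfr : ∀ μ, Module.finrank k (W μ) = Module.finrank k ((W μ).map L.mkQ) + 1 := by
    intro μ
    have h1 := LinearMap.finrank_range_add_finrank_ker (L.mkQ.domRestrict (W μ))
    rw [LinearMap.range_domRestrict] at h1
    have h2 : Module.finrank k (LinearMap.ker (L.mkQ.domRestrict (W μ))) = 1 := by
      rw [LinearMap.ker_domRestrict, Submodule.ker_mkQ, ← Submodule.finrank_map_subtype_eq,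
        Submodule.map_comap_subtype, inf_comm, hinf, finrank_span_singleton (hne μ)]
    omega
  have hLfr : Module.finrank k L = d + 1 := by
    rw [hL, LinearMap.finrank_range_of_inj hA]; simp
  refine ⟨d, A, T, hA, hAy, ?_, ?_, ?_, ?_, hinf⟩
  · rw [← hAy, hDA]
    constructor
    · intro h
      rw [map_eq_zero_iff B hB] at h
      by_contra hd
      have := congrFun h ⟨d - 1, by omega⟩
      rw [Pi.zero_apply, show Fin.succ (⟨d - 1, by omega⟩ : Fin d) = Fin.last d by
        ext; simp; omega] at this
      simp at this
    · rintro rfl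
      rw [map_eq_zero_iff B hB]
      exact Subsingleton.elim _ _
  · intro μ hμ
    have : 0 < Module.finrank k ((W μ).map L.mkQ) := by
      rw [Nat.pos_iff_ne_zero, Ne, Submodule.finrank_eq_zero]
      exact (hT μ).mp hμ
    have := hfr μ
    change 2 ≤ Module.finrank k (W μ)
    omega
  · intro μ hμ
    have h : (W μ).map L.mkQ = ⊥ := by simpa using (hT μ).not.mp hμ
    rwa [← LinearMap.le_ker_iff_map, Submodule.ker_mkQ] at h
  · change d + ∑ μ ∈ T, (Module.finrank k (W μ) - 1) + 1 = Module.finrank k V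
    have := Submodule.finrank_quotient_add_finrank L
    rw [← this, ← hsum, hLfr]
    simp only [hfr, Nat.add_sub_cancel]
    ring

/-- A matrix with two rows has rank at most one if and only if its rows are linearly dependent. -/
theorem rank_le_one_iff_exists_smul_eq {k : Type*} [Field k] {n : ℕ}
    (N : Matrix (Fin 2) (Fin n) k) :
    N.rank ≤ 1 ↔ ∃ a b : k, (a ≠ 0 ∨ b ≠ 0) ∧ a • N 0 = b • N 1 := by
  have h : N.rank ≤ 1 ↔ ¬ LinearIndependent k N.row := by
    rw [Matrix.rank_eq_finrank_span_row, linearIndependent_iff_card_le_finrank_span,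
      Fintype.card_fin, not_le, Nat.lt_succ_iff]
    rfl
  rw [h, show N.row = ![N 0, N 1] by ext1 i; fin_cases i <;> rfl, LinearIndependent.pair_iff]
  push Not
  constructor
  · rintro ⟨a, b, hab, hne⟩
    refine ⟨a, -b, ?_, ?_⟩
    · by_cases ha : a = 0
      · exact Or.inr (neg_ne_zero.mpr (hne ha))
      · exact Or.inl ha
    · rw [neg_smul]
      exact eq_neg_of_add_eq_zero_left hab
  · rintro ⟨a, b, hab, he⟩
    refine ⟨a, -b, ?_, ?_⟩
    · rw [neg_smul]
      exact add_neg_eq_zero.mpr he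
    · rintro rfl
      simpa using hab

/-- Two points with proportional representatives coincide. -/
theorem Projectivization.eq_of_rep_mem_span {k V : Type*} [Field k] [AddCommGroup V] [Module k V]
    {x y : Projectivization k V} (h : x.rep ∈ Submodule.span k {y.rep}) : x = y := by
  rw [Submodule.mem_span_singleton] at h
  rw [← x.mk_rep, ← y.mk_rep]
  exact (Projectivization.mk_eq_mk_iff' k _ _ _ _).mpr h

/-- The point spanned by a nonzero vector `v` has a representative proportional to `v`. -/
theorem Projectivization.span_rep_mk {k V : Type*} [Field k] [AddCommGroup V] [Module k V]
    {v : V} (hv : v ≠ 0) :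
    Submodule.span k {(Projectivization.mk k v hv).rep} = Submodule.span k {v} := by
  rw [← Projectivization.submodule_eq, Projectivization.submodule_mk]

/-- The representatives of the points of a non-degenerate set span the ambient space. -/
theorem NonDegenerate.span_eq_top {k : Type*} [Field k] {n : ℕ}
    {Z : Set (Projectivization k (Fin (n + 1) → k))} (h : NonDegenerate k n Z) :
    Submodule.span k (Projectivization.rep '' Z) = ⊤ := by
  by_contra hne
  obtain ⟨f, hf, hle⟩ := Submodule.exists_le_ker_of_lt_top _ (lt_top_iff_ne_top.mpr hne)
  exact hf (h f fun x hx => hle (Submodule.subset_span ⟨x, hx, rfl⟩))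

/-- A row defining the point `y` is a linear map whose kernel is the line `y`. -/
theorem RowDefinesPoint.ker_pi {k : Type*} [Field k] {n : ℕ}
    {r : Fin n → Module.Dual k (Fin (n + 1) → k)} {y : Projectivization k (Fin (n + 1) → k)}
    (h : RowDefinesPoint k n r y) :
    LinearMap.ker (LinearMap.pi r) = Submodule.span k {y.rep} := by
  apply le_antisymm
  · intro v hv
    by_cases hv0 : v = 0
    · simp [hv0]
    have hspan := Projectivization.span_rep_mk (k := k) hv0
    have hmem : Projectivization.mk k v hv0 ∈ {x | ∀ j, r j x.rep = 0} := by
      have : (Projectivization.mk k v hv0).rep ∈ LinearMap.ker (LinearMap.pi r) :=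
        (Submodule.span_singleton_le_iff_mem _ _).mpr hv
          (hspan ▸ Submodule.mem_span_singleton_self _)
      intro j
      exact congrFun (LinearMap.mem_ker.mp this) j
    rw [h.2] at hmem
    rw [← Set.mem_singleton_iff.mp hmem, hspan]
    exact Submodule.mem_span_singleton_self v
  · rw [Submodule.span_singleton_le_iff_mem, LinearMap.mem_ker]
    have hmem : y ∈ {x : Projectivization k (Fin (n + 1) → k) | ∀ j, r j x.rep = 0} := by
      rw [h.2]; rfl
    ext j
    exact hmem j

/-- If the rank-one locus of a matrix with non-proportional rows whose first row defines `y`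
contains the non-degenerate set `Z`, then `Z` lies on a Kronecker–Weierstrass variety. -/
theorem exists_kroneckerWeierstrass_of_matrix {k : Type*} [Field k] {n : ℕ}
    {Z : Set (Projectivization k (Fin (n + 1) → k))} (hnd : NonDegenerate k n Z)
    {y : Projectivization k (Fin (n + 1) → k)} (hy : y ∉ Z)
    {M : Fin 2 → Fin n → Module.Dual k (Fin (n + 1) → k)} (hM : LinearIndependent k M)
    (hrow : RowDefinesPoint k n (M 0) y) (hZ : ∀ z ∈ Z, InRankOneLocus k n M z) :
    ∃ (d s : ℕ) (Y : Set (Projectivization k (Fin (n + 1) → k))), Z ⊆ Y ∧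
        ((∃ C, IsKWpos k n d s Y C ∧ y ∈ C) ∨
          (d = 0 ∧ IsKW0 k n s Y y)) := by
  classical
  set π : (Fin (n + 1) → k) →ₗ[k] (Fin n → k) := LinearMap.pi (M 0) with hπ
  set φ : (Fin (n + 1) → k) →ₗ[k] (Fin n → k) := LinearMap.pi (M 1) with hφ
  have hker : LinearMap.ker π = Submodule.span k {y.rep} := hrow.ker_pi
  have hsurj : LinearMap.range π = ⊤ := by
    apply Submodule.eq_top_of_finrank_eq
    have := LinearMap.finrank_range_add_finrank_ker π
    rw [hker, finrank_span_singleton y.rep_nonzero] at this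
    simpa using this
  obtain ⟨g, hg⟩ := π.exists_rightInverse_of_surjective hsurj
  set D : (Fin (n + 1) → k) →ₗ[k] (Fin (n + 1) → k) := g ∘ₗ φ with hD
  have hπD : π ∘ₗ D = φ := by rw [hD, ← LinearMap.comp_assoc, hg, LinearMap.id_comp]
  have hπD' : ∀ x, π (D x) = φ x := fun x => LinearMap.congr_fun hπD x
  have hzπ : ∀ z ∈ Z, π z.rep ≠ 0 := by
    intro z hz h
    rw [← LinearMap.mem_ker, hker] at h
    exact hy (Projectivization.eq_of_rep_mem_span h ▸ hz)
  have hZμ : ∀ z ∈ Z, ∃ μ : k, π (D z.rep) = μ • π z.rep := by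
    intro z hz
    obtain ⟨a, b, hab, he⟩ := (rank_le_one_iff_exists_smul_eq _).mp (hZ z hz)
    replace he : a • π z.rep = b • φ z.rep := he
    have hb : b ≠ 0 := by
      rintro rfl
      rw [zero_smul, smul_eq_zero] at he
      exact hzπ z hz (he.resolve_left (by simpa using hab))
    refine ⟨b⁻¹ * a, ?_⟩
    rw [mul_smul, he, smul_smul, inv_mul_cancel₀ hb, one_smul, hπD']
  obtain ⟨d, A, T, hA, hAy, hd, hT2, hTn, hsum, hinf⟩ := exists_kronecker_decomposition π D
    y.rep_nonzero hker (Projectivization.rep '' Z) hnd.span_eq_top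
    (by rintro _ ⟨z, hz, rfl⟩; exact hZμ z hz)
  set W : k → Submodule k (Fin (n + 1) → k) := fun μ => LinearMap.ker (π ∘ₗ D - μ • π) with hW
  have hWmem : ∀ μ x, x ∈ W μ ↔ π (D x) = μ • π x := by
    intro μ x
    simp [hW, sub_eq_zero]
  have hlt : ∀ μ, Module.finrank k (W μ) < n + 1 := by
    intro μ
    have hne : W μ ≠ ⊤ := by
      intro h
      have he : φ = μ • π := by
        refine LinearMap.ext fun x => ?_
        rw [← hπD', ← sub_eq_zero]
        have : x ∈ W μ := h ▸ Submodule.mem_top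
        rw [hWmem] at this
        rw [this, LinearMap.smul_apply, sub_self]
      have hM' : M 1 = μ • M 0 := by
        refine funext fun j => LinearMap.ext fun x => ?_
        exact congrFun (LinearMap.congr_fun he x) j
      rw [show M = ![M 0, M 1] by ext1 i; fin_cases i <;> rfl, LinearIndependent.pair_iff] at hM
      simpa using (hM (-μ) 1 (by rw [hM', neg_smul, one_smul, neg_add_cancel])).2
    simpa using Submodule.finrank_lt hne
  set e := T.equivFin.symm
  have hnn : ∀ i, 1 ≤ Module.finrank k (W (e i)) - 1 ∧ Module.finrank k (W (e i)) - 1 ≤ n - 1 := by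
    intro i
    have h1 : 2 ≤ Module.finrank k (W (e i)) := hT2 _ (e i).2
    have h2 := hlt (e i)
    omega
  have hsum' : d + ∑ i, (Module.finrank k (W (e i)) - 1) = n := by
    rw [e.sum_comp fun μ : T => Module.finrank k (W μ) - 1,
      Finset.sum_coe_sort T fun μ => Module.finrank k (W μ) - 1]
    simpa using hsum
  have hfr : ∀ i, Module.finrank k (W (e i)) = Module.finrank k (W (e i)) - 1 + 1 := by
    intro i
    have h1 := hnn i
    omega
  have hWW : ∀ i j, i ≠ j → ∀ x ∈ projSet k (W (e i)) ∩ projSet k (W (e j)), x = y ∧ d = 0 := by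
    rintro i j hij x ⟨hi, hj⟩
    have hi' := (hWmem _ _).mp hi
    have hj' := (hWmem _ _).mp hj
    have hne : (e i : k) - e j ≠ 0 := by
      rw [sub_ne_zero]
      exact fun h => hij (e.injective (Subtype.ext h))
    have h0 : π x.rep = 0 := by
      have : ((e i : k) - e j) • π x.rep = 0 := by rw [sub_smul, ← hi', ← hj', sub_self]
      exact (smul_eq_zero.mp this).resolve_left hne
    have hxy : x = y := by
      rw [← LinearMap.mem_ker, hker] at h0
      exact Projectivization.eq_of_rep_mem_span h0
    refine ⟨hxy, hd.mp ?_⟩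
    rw [← hxy, hi', h0, smul_zero]
  have hnotT : ∀ z μ, z ∈ projSet k (W μ) → μ ∉ T → z.rep ∈ Submodule.span k
      {A fun i => (1 : k) ^ (d - (i : ℕ)) * μ ^ (i : ℕ)} := by
    intro z μ hz hμ
    rw [← hinf μ]
    exact ⟨hTn μ hμ hz, hz⟩
  refine ⟨d, T.card, ?_⟩
  rcases Nat.eq_zero_or_pos d with rfl | hd1
  · have hy0 : π y.rep = 0 := by
      rw [← LinearMap.mem_ker, hker]
      exact Submodule.mem_span_singleton_self _
    have hyW : ∀ μ, y ∈ projSet k (W μ) := by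
      intro μ
      refine (hWmem _ _).mpr ?_
      rw [hd.mpr rfl, hy0, smul_zero]
    refine ⟨⋃ i, projSet k (W (e i)), ?_, Or.inr ⟨rfl, fun i => Module.finrank k (W (e i)) - 1,
      fun i => W (e i), hnn, by simpa using hsum', hfr, fun i => hyW _, ?_, rfl⟩⟩
    · intro z hz
      obtain ⟨μ, hμ⟩ := hZμ z hz
      by_cases hμT : μ ∈ T
      · refine Set.mem_iUnion.mpr ⟨e.symm ⟨μ, hμT⟩, ?_⟩
        rw [e.apply_symm_apply]
        exact (hWmem _ _).mpr hμ
      · have h := hnotT z μ ((hWmem _ _).mpr hμ) hμT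
        have : (fun i : Fin (0 + 1) => (1 : k) ^ (0 - (i : ℕ)) * μ ^ (i : ℕ)) =
            Pi.single (Fin.last 0) 1 := by
          ext i
          fin_cases i
          simp
        rw [this, hAy] at h
        exact absurd (Projectivization.eq_of_rep_mem_span h ▸ hz) hy
    · intro i j hij
      refine Set.Subset.antisymm (fun x hx => (hWW i j hij x hx).1) ?_
      rintro _ rfl
      exact ⟨hyW _, hyW _⟩
  · set C : Set (Projectivization k (Fin (n + 1) → k)) := {x | ∃ s t c : k, c ≠ 0 ∧
          c • x.rep = A fun i => s ^ (d - (i : ℕ)) * t ^ (i : ℕ)} with hC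
    have hmemC : ∀ z : Projectivization k (Fin (n + 1) → k), ∀ μ, z.rep ∈ Submodule.span k
        {A fun i => (1 : k) ^ (d - (i : ℕ)) * μ ^ (i : ℕ)} → z ∈ C := by
      intro z μ hz
      obtain ⟨c, hc⟩ := Submodule.mem_span_singleton.mp hz
      have hc0 : c ≠ 0 := by
        rintro rfl
        exact z.rep_nonzero (by rw [← hc, zero_smul])
      exact ⟨1, μ, c⁻¹, inv_ne_zero hc0, by rw [← hc, smul_smul, inv_mul_cancel₀ hc0, one_smul]⟩
    refine ⟨C ∪ ⋃ i, projSet k (W (e i)), ?_, Or.inl ⟨C, ⟨hd1,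
      fun i => Module.finrank k (W (e i)) - 1, LinearMap.range A, fun i => W (e i), hnn, hsum',
      ⟨A, hA, rfl, rfl⟩, hfr, ?_, ?_, rfl⟩, ?_⟩⟩
    · intro z hz
      obtain ⟨μ, hμ⟩ := hZμ z hz
      by_cases hμT : μ ∈ T
      · refine Or.inr (Set.mem_iUnion.mpr ⟨e.symm ⟨μ, hμT⟩, ?_⟩)
        rw [e.apply_symm_apply]
        exact (hWmem _ _).mpr hμ
      · exact Or.inl (hmemC z μ (hnotT z μ ((hWmem _ _).mpr hμ) hμT))
    · intro i
      have hne : (A fun j => (1 : k) ^ (d - (j : ℕ)) * (e i : k) ^ (j : ℕ)) ≠ 0 := by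
        intro h
        rw [map_eq_zero_iff A hA] at h
        simpa using congrFun h 0
      have hsp := Projectivization.span_rep_mk (k := k) hne
      refine ⟨Projectivization.mk k _ hne, hmemC _ (e i) ?_, ?_⟩
      · rw [← hsp]
        exact Submodule.mem_span_singleton_self _
      · have hset : projSet k (LinearMap.range A) ∩ projSet k (W (e i)) =
            {x | x.rep ∈ LinearMap.range A ⊓ W (e i)} := rfl
        rw [hset, hinf (e i), ← hsp]
        refine Set.Subset.antisymm (fun x hx => Projectivization.eq_of_rep_mem_span hx) ?_
        rintro _ rfl
        exact Submodule.mem_span_singleton_self _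
    · intro i j hij
      rw [Set.eq_empty_iff_forall_notMem]
      intro x hx
      have := (hWW i j hij x hx).2
      omega
    · refine ⟨0, 1, 1, one_ne_zero, ?_⟩
      rw [one_smul, ← hAy]
      congr 1
      ext i
      induction i using Fin.lastCases with
      | last => simp
      | cast i =>
        have h' : d - (i : ℕ) ≠ 0 := by omega
        simp [h', Fin.castSucc_ne_last]

/-- A pencil of linear maps `(π, φ)` into an `n`-dimensional space, where the kernel of `π` is the
line `y`, gives rise to a `2 × n` matrix of linear forms. -/
theorem exists_matrix_of_pencil {k E : Type*} [Field k] [AddCommGroup E] [Module k E]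
    [FiniteDimensional k E] {n : ℕ} (hn : n ≠ 0) (hE : Module.finrank k E = n)
    {y : Projectivization k (Fin (n + 1) → k)} {Z : Set (Projectivization k (Fin (n + 1) → k))}
    (π φ : (Fin (n + 1) → k) →ₗ[k] E) (hker : LinearMap.ker π = Submodule.span k {y.rep})
    (hφ : ∀ c : k, φ ≠ c • π)
    (hZ : ∀ z ∈ Z, ∃ a b : k, (a ≠ 0 ∨ b ≠ 0) ∧ a • π z.rep = b • φ z.rep) :
    ∃ M : Fin 2 → Fin n → Module.Dual k (Fin (n + 1) → k),
      LinearIndependent k M ∧ RowDefinesPoint k n (M 0) y ∧ ∀ z ∈ Z, InRankOneLocus k n M z := by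
  have hsurj : LinearMap.range π = ⊤ := by
    apply Submodule.eq_top_of_finrank_eq
    have := LinearMap.finrank_range_add_finrank_ker π
    rw [hker, finrank_span_singleton y.rep_nonzero] at this
    simpa [hE] using this
  set e : E ≃ₗ[k] (Fin n → k) := LinearEquiv.ofFinrankEq _ _ (by simpa using hE)
  set r : ((Fin (n + 1) → k) →ₗ[k] E) → Fin n → Module.Dual k (Fin (n + 1) → k) :=
    fun f j => LinearMap.proj j ∘ₗ e.toLinearMap ∘ₗ f with hr
  have hr_apply : ∀ f x, (fun j => r f j x) = e (f x) := fun f x => rfl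
  refine ⟨![r π, r φ], ?_, ⟨?_, ?_⟩, ?_⟩
  · rw [LinearIndependent.pair_iff]
    intro s t hst
    have hcomb : ∀ x, s • π x + t • φ x = 0 := by
      intro x
      apply e.injective
      rw [map_add, map_smul, map_smul, map_zero]
      ext j
      exact LinearMap.congr_fun (congrFun hst j) x
    have ht : t = 0 := by
      by_contra ht
      apply hφ (-(t⁻¹ * s))
      refine LinearMap.ext fun x => ?_
      have h := congrArg (fun v => t⁻¹ • v) (hcomb x)
      simp only [smul_add, smul_smul, inv_mul_cancel₀ ht, one_smul, smul_zero] at h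
      rw [LinearMap.smul_apply, neg_smul]
      exact eq_neg_of_add_eq_zero_right h
    refine ⟨?_, ht⟩
    subst ht
    by_contra hs
    have hπ0 : LinearMap.ker π = ⊤ := by
      rw [eq_top_iff]
      intro x _
      have := hcomb x
      rw [zero_smul, add_zero] at this
      exact (smul_eq_zero.mp this).resolve_left hs
    have := finrank_span_singleton (K := k) y.rep_nonzero
    rw [← hker, hπ0] at this
    simp at this
    exact hn this
  · change LinearIndependent k (r π)
    rw [Fintype.linearIndependent_iff]
    intro g hg j
    obtain ⟨x, hx⟩ := (LinearMap.range_eq_top.mp hsurj) (e.symm (Pi.single j 1))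
    have h := LinearMap.congr_fun hg x
    have hx' : ∀ i, r π i x = (Pi.single j 1 : Fin n → k) i := by
      intro i
      rw [← e.apply_symm_apply (Pi.single j 1), ← hx, ← hr_apply]
    simpa [LinearMap.sum_apply, hx', Pi.single_apply] using h
  · have h0 : ∀ x : Projectivization k (Fin (n + 1) → k),
        (∀ j, r π j x.rep = 0) ↔ x.rep ∈ Submodule.span k {y.rep} := by
      intro x
      rw [← hker, LinearMap.mem_ker, ← e.map_eq_zero_iff, ← hr_apply, funext_iff]
      rfl
    ext x
    refine (h0 x).trans ⟨fun h => Projectivization.eq_of_rep_mem_span h, ?_⟩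
    rintro rfl
    exact Submodule.mem_span_singleton_self _
  · intro z hz
    obtain ⟨a, b, hab, h⟩ := hZ z hz
    refine (rank_le_one_iff_exists_smul_eq _).mpr ⟨a, b, hab, ?_⟩
    have := congrArg e h
    rw [map_smul, map_smul] at this
    exact this

/-- The matrix for a non-degenerate set contained in the union of two proper subspaces meeting
exactly in the point `y`. -/
theorem exists_matrix_of_two_subspaces {k : Type*} [Field k] {n : ℕ} (hn : n ≠ 0)
    {y : Projectivization k (Fin (n + 1) → k)} {Z : Set (Projectivization k (Fin (n + 1) → k))}
    (A B : Submodule k (Fin (n + 1) → k)) (hA : A ≠ ⊤) (hB : B ≠ ⊤) (hsup : A ⊔ B = ⊤)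
    (hyA : y.rep ∈ A) (hyB : y.rep ∈ B)
    (hdim : Module.finrank k A + Module.finrank k B ≤ n + 2)
    (hZ : ∀ z ∈ Z, z.rep ∈ A ∨ z.rep ∈ B) :
    ∃ M : Fin 2 → Fin n → Module.Dual k (Fin (n + 1) → k),
      LinearIndependent k M ∧ RowDefinesPoint k n (M 0) y ∧ ∀ z ∈ Z, InRankOneLocus k n M z := by
  set S := Submodule.span k {y.rep} with hS
  have hSfr : Module.finrank k S = 1 := finrank_span_singleton y.rep_nonzero
  have hSA : S ≤ A := (Submodule.span_singleton_le_iff_mem _ _).mpr hyA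
  have hSB : S ≤ B := (Submodule.span_singleton_le_iff_mem _ _).mpr hyB
  have hinf : S = A ⊓ B := by
    refine Submodule.eq_of_le_of_finrank_le (le_inf hSA hSB) ?_
    have := Submodule.finrank_sup_add_finrank_inf_eq A B
    rw [hsup, finrank_top, Module.finrank_fin_fun] at this
    omega
  obtain ⟨B', hdisj, hB'⟩ := IsModularLattice.exists_disjoint_and_sup_eq hSB
  have hcompl : IsCompl B' A := by
    constructor
    · rw [Submodule.disjoint_def]
      intro x hx hxA
      refine (Submodule.disjoint_def.mp hdisj) x ?_ hx
      rw [hinf]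
      exact ⟨hxA, hB' ▸ Submodule.mem_sup_right hx⟩
    · rw [codisjoint_iff, ← hsup, ← hB', ← sup_assoc, sup_eq_left.mpr hSA, sup_comm]
  set φ := S.mkQ ∘ₗ B'.projection A hcompl with hφ
  have hφA : ∀ x ∈ A, φ x = 0 := by
    intro x hx
    rw [hφ, LinearMap.comp_apply, (Submodule.projection_apply_eq_zero_iff hcompl).mpr hx, map_zero]
  have hφB : ∀ x ∈ B, φ x = S.mkQ x := by
    intro x hx
    rw [← hB'] at hx
    obtain ⟨v, hv, w, hw, rfl⟩ := Submodule.mem_sup.mp hx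
    rw [map_add, hφA v (hSA hv), map_add, hφ, LinearMap.comp_apply,
      Submodule.projection_apply_of_mem_left hcompl hw]
    congr 1
    exact ((Submodule.Quotient.mk_eq_zero S).mpr hv).symm
  refine exists_matrix_of_pencil hn ?_ S.mkQ φ (Submodule.ker_mkQ S) ?_ ?_
  · have := Submodule.finrank_quotient_add_finrank S
    rw [hSfr, Module.finrank_fin_fun] at this
    omega
  · intro c hc
    have hAS : ∃ a ∈ A, a ∉ S := by
      by_contra! h
      exact hB (by rw [← hsup]; exact (sup_eq_right.mpr (le_trans h hSB)).symm)
    have hBS : ∃ b ∈ B, b ∉ S := by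
      by_contra! h
      exact hA (by rw [← hsup]; exact (sup_eq_left.mpr (le_trans h hSA)).symm)
    obtain ⟨a, ha, haS⟩ := hAS
    obtain ⟨b, hb, hbS⟩ := hBS
    have h1 := hφA a ha
    rw [hc, LinearMap.smul_apply, smul_eq_zero] at h1
    have hc0 : c = 0 := h1.resolve_right (by simpa using haS)
    have h2 := hφB b hb
    rw [hc, hc0, zero_smul, LinearMap.zero_apply] at h2
    exact hbS (by simpa using h2.symm)
  · intro z hz
    rcases hZ z hz with h | h
    · exact ⟨0, 1, by simp, by rw [hφA _ h]; simp⟩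
    · exact ⟨1, 1, by simp, by rw [hφB _ h]⟩

/-- Adjoining subspaces which all meet `X` raises the dimension by at most their projective
dimensions. -/
theorem finrank_sup_finset_sup_le {k V ι : Type*} [Field k] [AddCommGroup V] [Module k V]
    [FiniteDimensional k V] (X : Submodule k V) (W : ι → Submodule k V) (m : ι → ℕ)
    (hW : ∀ i, Module.finrank k (W i) = m i + 1) (hX : ∀ i, X ⊓ W i ≠ ⊥) (T : Finset ι) :
    Module.finrank k (X ⊔ T.sup W : Submodule k V) ≤ Module.finrank k X + ∑ i ∈ T, m i := by
  classical
  induction T using Finset.induction_on with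
  | empty =>
    have h : X ⊔ (∅ : Finset ι).sup W = X := by rw [Finset.sup_empty, sup_bot_eq]
    rw [h, Finset.sum_empty, add_zero]
  | insert i T hi ih =>
    rw [Finset.sup_insert, Finset.sum_insert hi, sup_left_comm, sup_comm]
    have h1 := Submodule.finrank_sup_add_finrank_inf_eq (X ⊔ T.sup W) (W i)
    have h2 : (X ⊔ T.sup W) ⊓ W i ≠ ⊥ :=
      ne_bot_of_le_ne_bot (hX i) (inf_le_inf_right _ le_sup_left)
    have h3 := mt Submodule.finrank_eq_zero.mp h2
    have h4 := hW i
    omega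

/-- Two subspaces meeting in a single projective point meet in the corresponding line. -/
theorem inf_eq_span_of_projSet_inter_eq {k : Type*} [Field k] {n : ℕ}
    {L W : Submodule k (Fin (n + 1) → k)} {p : Projectivization k (Fin (n + 1) → k)}
    (h : projSet k L ∩ projSet k W = {p}) : L ⊓ W = Submodule.span k {p.rep} := by
  apply le_antisymm
  · intro v hv
    by_cases hv0 : v = 0
    · simp [hv0]
    have hspan := Projectivization.span_rep_mk (k := k) hv0
    have hmem : (Projectivization.mk k v hv0).rep ∈ L ⊓ W :=
      (Submodule.span_singleton_le_iff_mem _ _).mpr hv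
        (hspan ▸ Submodule.mem_span_singleton_self _)
    have hp : Projectivization.mk k v hv0 ∈ projSet k L ∩ projSet k W := hmem
    rw [h] at hp
    rw [← Set.mem_singleton_iff.mp hp, hspan]
    exact Submodule.mem_span_singleton_self v
  · rw [Submodule.span_singleton_le_iff_mem]
    have hp : p ∈ projSet k L ∩ projSet k W := by rw [h]; rfl
    exact hp

/-- A common factorization `π z = α e`, `φ z = β e` forces `π z` and `φ z` to be dependent. -/
theorem exists_smul_eq_smul_of_factor {k E : Type*} [Field k] [AddCommGroup E] [Module k E]
    {v w e : E} {α β : k} (hv : v = α • e) (hw : w = β • e) :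
    ∃ a b : k, (a ≠ 0 ∨ b ≠ 0) ∧ a • v = b • w := by
  by_cases h : α = 0 ∧ β = 0
  · exact ⟨1, 1, by simp, by rw [hv, hw, h.1, h.2]⟩
  · refine ⟨β, α, by tauto, ?_⟩
    rw [hv, hw, smul_smul, smul_smul, mul_comm]

/-- The member `p a + q b` of the Kronecker–Weierstrass pencil: `a` and `b` are the two shifts on
the block of the rational normal curve, and the remaining blocks are scalar. -/
def kroneckerPencil {k : Type*} [Field k] (d : ℕ) {ι : Type*} (F : ι → Type*)
    [∀ i, AddCommGroup (F i)] [∀ i, Module k (F i)] (σ τ : ι → k) (p q : k) :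
    ((Fin (d + 1) → k) × (∀ i, F i)) →ₗ[k] ((Fin d → k) × (∀ i, F i)) :=
  LinearMap.prodMap (p • LinearMap.funLeft k k Fin.castSucc + q • LinearMap.funLeft k k Fin.succ)
    (LinearMap.pi fun i => (p * σ i + q * τ i) • LinearMap.proj i)

theorem kroneckerPencil_apply {k : Type*} [Field k] (d : ℕ) {ι : Type*} (F : ι → Type*)
    [∀ i, AddCommGroup (F i)] [∀ i, Module k (F i)] (σ τ : ι → k) (p q : k)
    (u : Fin (d + 1) → k) (w : ∀ i, F i) :
    kroneckerPencil d F σ τ p q (u, w) =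
      (fun i => p * u i.castSucc + q * u i.succ, fun i => (p * σ i + q * τ i) • w i) := rfl

/-- On a vector lying over the point `(s : t)` all members of the pencil are proportional. -/
theorem kroneckerPencil_apply_veronese {k : Type*} [Field k] (d : ℕ) {ι : Type*} (F : ι → Type*)
    [∀ i, AddCommGroup (F i)] [∀ i, Module k (F i)] (σ τ : ι → k) (p q s t c : k) (w : ∀ i, F i)
    (hw : ∀ i, w i ≠ 0 → s = σ i ∧ t = τ i) :
    kroneckerPencil d F σ τ p q
        (c • fun i : Fin (d + 1) => s ^ (d - (i : ℕ)) * t ^ (i : ℕ), w) =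
      (p * s + q * t) • ((fun i : Fin d => c * (s ^ (d - 1 - i : ℕ) * t ^ (i : ℕ)), w) :
        (Fin d → k) × (∀ i, F i)) := by
  rw [kroneckerPencil_apply]
  refine Prod.ext (funext fun i => ?_) (funext fun i => ?_)
  · have h := veronese_castSucc_succ s t i
    simp only [Pi.smul_apply, Prod.smul_mk, smul_eq_mul]
    rw [h.1, h.2]
    ring
  · simp only [Pi.smul_apply, Prod.smul_mk]
    by_cases h : w i = 0
    · rw [h, smul_zero, smul_zero]
    · rw [(hw i h).1, (hw i h).2]

/-- The matrix for a non-degenerate set on a Kronecker–Weierstrass variety with a curve part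
through `y`, when `y` does not lie on any of the linear components. -/
theorem exists_matrix_of_curve {k : Type*} [Field k] {n d s : ℕ} (hd : 1 ≤ d)
    {y : Projectivization k (Fin (n + 1) → k)} {Z : Set (Projectivization k (Fin (n + 1) → k))}
    (A : (Fin (d + 1) → k) →ₗ[k] (Fin (n + 1) → k)) (hA : Function.Injective A)
    (W : Fin s → Submodule k (Fin (n + 1) → k)) (m : Fin s → ℕ) (hsum : d + ∑ i, m i = n)
    (hW : ∀ i, Module.finrank k (W i) = m i + 1) (σ τ : Fin s → k)
    (hστ : ∀ i, (A fun j => σ i ^ (d - (j : ℕ)) * τ i ^ (j : ℕ)) ≠ 0)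
    (hpW : ∀ i, (A fun j => σ i ^ (d - (j : ℕ)) * τ i ^ (j : ℕ)) ∈ W i)
    (hsup : LinearMap.range A ⊔ ⨆ i, W i = ⊤)
    {s₀ t₀ c₀ : k} (hc₀ : c₀ ≠ 0)
    (hy : c₀ • y.rep = A fun i => s₀ ^ (d - (i : ℕ)) * t₀ ^ (i : ℕ))
    (hyW : ∀ i, y.rep ∉ W i)
    (hZ : ∀ z ∈ Z, (∃ s t c : k, c ≠ 0 ∧
      c • z.rep = A fun i => s ^ (d - (i : ℕ)) * t ^ (i : ℕ)) ∨ ∃ i, z.rep ∈ W i) :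
    ∃ M : Fin 2 → Fin n → Module.Dual k (Fin (n + 1) → k),
      LinearIndependent k M ∧ RowDefinesPoint k n (M 0) y ∧ ∀ z ∈ Z, InRankOneLocus k n M z := by
  classical
  set P : Fin s → Fin (n + 1) → k := fun i => A fun j => σ i ^ (d - (j : ℕ)) * τ i ^ (j : ℕ)
    with hP
  have hW' : ∀ i, ∃ W' : Submodule k (Fin (n + 1) → k),
      Disjoint (Submodule.span k {P i}) W' ∧ Submodule.span k {P i} ⊔ W' = W i := fun i =>
    IsModularLattice.exists_disjoint_and_sup_eq
      ((Submodule.span_singleton_le_iff_mem _ _).mpr (hpW i))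
  choose W' hdisj hsupW using hW'
  have hW'fr : ∀ i, Module.finrank k (W' i) = m i := by
    intro i
    have := Submodule.finrank_sup_add_finrank_inf_eq (Submodule.span k {P i}) (W' i)
    rw [hsupW, hW, (hdisj i).eq_bot, finrank_bot, finrank_span_singleton (hστ i)] at this
    omega
  set Θ : ((Fin (d + 1) → k) × (∀ i, W' i)) →ₗ[k] (Fin (n + 1) → k) :=
    A.coprod (LinearMap.lsum k (fun i => W' i) ℕ fun i => (W' i).subtype) with hΘ
  have hΘs : ∀ u i (w : W' i), Θ (u, Pi.single i w) = A u + w := by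
    intro u i w
    simp only [hΘ, LinearMap.coprod_apply, LinearMap.lsum_piSingle, Submodule.coe_subtype]
  have hΘ0 : ∀ u, Θ (u, 0) = A u := by
    intro u
    simp [hΘ, LinearMap.coprod_apply]
  have hΘsurj : Function.Surjective Θ := by
    rw [← LinearMap.range_eq_top, eq_top_iff, ← hsup]
    have hA' : LinearMap.range A ≤ LinearMap.range Θ := by
      rintro _ ⟨u, rfl⟩
      exact ⟨_, hΘ0 u⟩
    refine sup_le hA' (iSup_le fun i => ?_)
    rw [← hsupW i]
    refine sup_le ?_ ?_
    · rw [Submodule.span_singleton_le_iff_mem]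
      exact hA' ⟨_, rfl⟩
    · intro w hw
      exact ⟨(0, Pi.single i ⟨w, hw⟩), by rw [hΘs, map_zero, zero_add]⟩
  have hΘinj : Function.Injective Θ := by
    rw [LinearMap.injective_iff_surjective_of_finrank_eq_finrank]
    · exact hΘsurj
    · rw [Module.finrank_prod, Module.finrank_fin_fun, Module.finrank_fin_fun,
        Module.finrank_pi_fintype]
      simp only [hW'fr]
      omega
  set e := LinearEquiv.ofBijective Θ ⟨hΘinj, hΘsurj⟩ with he
  have hesymm : ∀ u, e.symm (Θ u) = u := fun u => e.symm_apply_apply u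
  have hst₀ : s₀ ≠ 0 ∨ t₀ ≠ 0 := by
    by_contra! h
    have hne : c₀ • y.rep ≠ 0 := smul_ne_zero hc₀ y.rep_nonzero
    apply hne
    rw [hy, map_eq_zero_iff A hA, h.1, h.2]
    ext i
    by_cases hi : (i : ℕ) = 0
    · have : d ≠ 0 := by omega
      simp [hi, this]
    · simp [hi]
  have hcoef : ∀ i, t₀ * σ i + -s₀ * τ i ≠ 0 := by
    intro i h
    obtain ⟨c, hc⟩ := exists_eq_smul_veronese hst₀
      (fun j : Fin (d + 1) => σ i ^ (d - (j : ℕ)) * τ i ^ (j : ℕ)) (by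
        intro j
        have hj := veronese_castSucc_succ (σ i) (τ i) j
        rw [hj.1, hj.2]
        linear_combination (σ i ^ (d - 1 - j : ℕ) * τ i ^ (j : ℕ)) * h)
    have hPi : P i = (c * c₀) • y.rep := by
      rw [hP, mul_smul, hy, ← map_smul, ← hc]
    have hcc : c * c₀ ≠ 0 := by
      intro h0
      exact hστ i (by change P i = 0; rw [hPi, h0, zero_smul])
    apply hyW i
    have := hpW i
    change P i ∈ W i at this
    rwa [hPi, Submodule.smul_mem_iff _ hcc] at this
  obtain ⟨p, q, hpq⟩ : ∃ p q : k, ∀ c, ¬ (p = c * t₀ ∧ q = c * -s₀) := by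
    by_cases ht : t₀ = 0
    · exact ⟨1, 0, by simp [ht]⟩
    · refine ⟨0, 1, fun c hc => ?_⟩
      have : c = 0 := by simpa [ht] using hc.1.symm
      simp [this] at hc
  set K := kroneckerPencil d (fun i => W' i) σ τ with hK
  have hlocus : ∀ (x : Fin (n + 1) → k) (s t c : k) (w : ∀ i, W' i),
      (∀ i, w i ≠ 0 → s = σ i ∧ t = τ i) →
      x = Θ (c • fun i : Fin (d + 1) => s ^ (d - (i : ℕ)) * t ^ (i : ℕ), w) →
      ∃ a b : k, (a ≠ 0 ∨ b ≠ 0) ∧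
        a • (K t₀ (-s₀) ∘ₗ e.symm.toLinearMap) x = b • (K p q ∘ₗ e.symm.toLinearMap) x := by
    rintro x s t c w hw rfl
    simp only [LinearMap.comp_apply, LinearEquiv.coe_coe, hesymm]
    exact exists_smul_eq_smul_of_factor (E := (Fin d → k) × (∀ i, W' i))
      (kroneckerPencil_apply_veronese d (fun i => W' i) σ τ _ _ s t c w hw)
      (kroneckerPencil_apply_veronese d (fun i => W' i) σ τ _ _ s t c w hw)
  refine exists_matrix_of_pencil (E := (Fin d → k) × (∀ i, W' i)) (by omega) ?_
    (K t₀ (-s₀) ∘ₗ e.symm.toLinearMap) (K p q ∘ₗ e.symm.toLinearMap) ?_ ?_ ?_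
  · rw [Module.finrank_prod, Module.finrank_fin_fun, Module.finrank_pi_fintype]
    simp only [hW'fr]
    exact hsum
  · apply le_antisymm
    · intro x hx
      obtain ⟨⟨u, w⟩, rfl⟩ := hΘsurj x
      rw [LinearMap.mem_ker, LinearMap.comp_apply, LinearEquiv.coe_coe, hesymm, hK,
        kroneckerPencil_apply, Prod.mk_eq_zero] at hx
      obtain ⟨c, hc⟩ := exists_eq_smul_veronese hst₀ u fun i => by
        have := congrFun hx.1 i
        rw [Pi.zero_apply] at this
        linear_combination this
      have hw : w = 0 := by
        ext1 i
        exact (smul_eq_zero.mp (congrFun hx.2 i)).resolve_left (hcoef i)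
      rw [hw, hΘ0, hc, map_smul, ← hy, smul_smul]
      exact Submodule.smul_mem _ _ (Submodule.mem_span_singleton_self _)
    · rw [Submodule.span_singleton_le_iff_mem, ← Submodule.smul_mem_iff _ hc₀, hy, ← hΘ0,
        LinearMap.mem_ker, LinearMap.comp_apply, LinearEquiv.coe_coe, hesymm]
      have := kroneckerPencil_apply_veronese d (fun i => W' i) σ τ t₀ (-s₀) s₀ t₀ 1 0
        (by simp)
      rw [one_smul] at this
      rw [this, show t₀ * s₀ + -s₀ * t₀ = 0 by ring, zero_smul]
  · intro c hc
    have h : ∀ (u : Fin (d + 1) → k) (i : Fin d), p * u i.castSucc + q * u i.succ =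
        c * (t₀ * u i.castSucc + -s₀ * u i.succ) := by
      intro u i
      have := LinearMap.congr_fun hc (Θ (u, 0))
      rw [LinearMap.smul_apply, LinearMap.comp_apply, LinearMap.comp_apply, LinearEquiv.coe_coe,
        hesymm, hK, kroneckerPencil_apply, kroneckerPencil_apply] at this
      exact congrFun (congrArg Prod.fst this) i
    set i₀ : Fin d := ⟨0, hd⟩
    have hne : i₀.castSucc ≠ i₀.succ := i₀.castSucc_lt_succ.ne
    have h1 := h (Pi.single i₀.castSucc 1) i₀
    have h2 := h (Pi.single i₀.succ 1) i₀
    simp only [Pi.single_eq_same, Pi.single_eq_of_ne hne, Pi.single_eq_of_ne hne.symm, mul_one,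
      mul_zero, add_zero, zero_add] at h1 h2
    exact hpq c ⟨h1, h2⟩
  · intro z hz
    rcases hZ z hz with ⟨s, t, c, hc, hz'⟩ | ⟨i, hi⟩
    · refine hlocus z.rep s t c⁻¹ 0 (by simp) ?_
      rw [hΘ0, map_smul, ← hz', smul_smul, inv_mul_cancel₀ hc, one_smul]
    · rw [← hsupW i] at hi
      obtain ⟨v, hv, w, hw, hvw⟩ := Submodule.mem_sup.mp hi
      obtain ⟨c, rfl⟩ := Submodule.mem_span_singleton.mp hv
      refine hlocus z.rep (σ i) (τ i) c (Pi.single i ⟨w, hw⟩) ?_ ?_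
      · intro j hj
        by_cases hij : j = i
        · rw [hij]; exact ⟨rfl, rfl⟩
        · rw [Pi.single_eq_of_ne hij] at hj
          exact absurd rfl hj
      · rw [hΘs, map_smul, ← hvw]

/-- A non-degenerate set on a Kronecker–Weierstrass variety of type `(0; s)` lies in the rank-one
locus of a matrix whose first row defines the distinguished point. -/
theorem exists_matrix_of_isKW0 {k : Type*} [Field k] {n s : ℕ} (hn : 2 ≤ n)
    {y : Projectivization k (Fin (n + 1) → k)} {Z Y : Set (Projectivization k (Fin (n + 1) → k))}
    (hnd : NonDegenerate k n Z) (hZY : Z ⊆ Y) (hY : IsKW0 k n s Y y) :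
    ∃ M : Fin 2 → Fin n → Module.Dual k (Fin (n + 1) → k),
      LinearIndependent k M ∧ RowDefinesPoint k n (M 0) y ∧ ∀ z ∈ Z, InRankOneLocus k n M z := by
  classical
  obtain ⟨m, W, hm, hsum, hW, hyW, -, rfl⟩ := hY
  have hs : 0 < s := by
    rcases Nat.eq_zero_or_pos s with rfl | h
    · simp at hsum
      omega
    · exact h
  set i₀ : Fin s := ⟨0, hs⟩
  set S := Submodule.span k {y.rep} with hS
  have hSW : ∀ i, S ≤ W i := fun i => (Submodule.span_singleton_le_iff_mem _ _).mpr (hyW i)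
  have hSne : S ≠ ⊥ := by simpa [hS] using y.rep_nonzero
  set B := S ⊔ (Finset.univ.erase i₀).sup W with hB
  have hBfr : Module.finrank k B ≤ 1 + ∑ i ∈ Finset.univ.erase i₀, m i := by
    have h := finrank_sup_finset_sup_le S W m hW (fun i => by rwa [inf_eq_left.mpr (hSW i)])
      (Finset.univ.erase i₀)
    rwa [finrank_span_singleton (K := k) y.rep_nonzero] at h
  have hsum' := Finset.add_sum_erase Finset.univ m (Finset.mem_univ i₀)
  rw [hsum] at hsum'
  have hmem : ∀ z ∈ Z, z.rep ∈ W i₀ ∨ z.rep ∈ B := by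
    intro z hz
    obtain ⟨i, hi⟩ := Set.mem_iUnion.mp (hZY hz)
    by_cases hii : i = i₀
    · exact Or.inl (hii ▸ hi)
    · exact Or.inr ((Finset.le_sup (f := W) (Finset.mem_erase.mpr ⟨hii, Finset.mem_univ i⟩)).trans
        le_sup_right hi)
  have h0 := hm i₀
  have hW0 := hW i₀
  refine exists_matrix_of_two_subspaces (by omega) (W i₀) B ?_ ?_ ?_ (hyW _)
    (Submodule.mem_sup_left (Submodule.mem_span_singleton_self _)) (by omega) hmem
  · intro h
    rw [h, finrank_top, Module.finrank_fin_fun] at hW0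
    omega
  · intro h
    rw [h, finrank_top, Module.finrank_fin_fun] at hBfr
    omega
  · rw [eq_top_iff, ← hnd.span_eq_top, Submodule.span_le]
    rintro _ ⟨z, hz, rfl⟩
    exact (hmem z hz).elim (fun h => Submodule.mem_sup_left h) fun h => Submodule.mem_sup_right h

/-- A non-degenerate set on a Kronecker–Weierstrass variety with curve part `C` lies in the
rank-one locus of a matrix whose first row defines a given point of `C`. -/
theorem exists_matrix_of_isKWpos {k : Type*} [Field k] {n d s : ℕ}
    {y : Projectivization k (Fin (n + 1) → k)}
    {Z Y C : Set (Projectivization k (Fin (n + 1) → k))}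
    (hnd : NonDegenerate k n Z) (hZY : Z ⊆ Y) (hY : IsKWpos k n d s Y C) (hyC : y ∈ C) :
    ∃ M : Fin 2 → Fin n → Module.Dual k (Fin (n + 1) → k),
      LinearIndependent k M ∧ RowDefinesPoint k n (M 0) y ∧ ∀ z ∈ Z, InRankOneLocus k n M z := by
  classical
  obtain ⟨hd, m, L, W, hm, hsum, ⟨A, hA, rfl, rfl⟩, hW, hp, -, rfl⟩ := hY
  choose p hpC hpW using hp
  choose σ τ c hc hpA using hpC
  have hinf : ∀ i, LinearMap.range A ⊓ W i = Submodule.span k {(p i).rep} := fun i =>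
    inf_eq_span_of_projSet_inter_eq (hpW i)
  have hpmem : ∀ i, (p i).rep ∈ W i := by
    intro i
    have : (p i).rep ∈ LinearMap.range A ⊓ W i := by
      rw [hinf]; exact Submodule.mem_span_singleton_self _
    exact this.2
  have hLfr : Module.finrank k (LinearMap.range A) = d + 1 := by
    rw [LinearMap.finrank_range_of_inj hA]; simp
  obtain ⟨s₀, t₀, c₀, hc₀, hy⟩ := hyC
  have hcurve : ∀ z : Projectivization k (Fin (n + 1) → k), (∃ s t c : k, c ≠ 0 ∧
      c • z.rep = A fun i => s ^ (d - (i : ℕ)) * t ^ (i : ℕ)) → z.rep ∈ LinearMap.range A := by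
    rintro z ⟨s, t, c, hc, h⟩
    rw [← Submodule.smul_mem_iff _ hc]
    exact ⟨_, h.symm⟩
  have hmem : ∀ z ∈ Z, (∃ s t c : k, c ≠ 0 ∧
      c • z.rep = A fun i => s ^ (d - (i : ℕ)) * t ^ (i : ℕ)) ∨ ∃ i, z.rep ∈ W i := fun z hz =>
    (hZY hz).imp id (Set.mem_iUnion (s := fun i => projSet k (W i))).mp
  by_cases hyW : ∃ i, y.rep ∈ W i
  · obtain ⟨i₀, hi₀⟩ := hyW
    set B := LinearMap.range A ⊔ (Finset.univ.erase i₀).sup W with hB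
    have hBfr : Module.finrank k B ≤ d + 1 + ∑ i ∈ Finset.univ.erase i₀, m i := by
      rw [← hLfr]
      refine finrank_sup_finset_sup_le _ W m hW (fun i => ?_) _
      rw [hinf]
      simpa using (p i).rep_nonzero
    have hsum' := Finset.add_sum_erase Finset.univ m (Finset.mem_univ i₀)
    have hmem' : ∀ z ∈ Z, z.rep ∈ W i₀ ∨ z.rep ∈ B := by
      intro z hz
      rcases hmem z hz with h | ⟨i, hi⟩
      · exact Or.inr (Submodule.mem_sup_left (hcurve z h))
      by_cases hii : i = i₀
      · exact Or.inl (hii ▸ hi)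
      · exact Or.inr ((Finset.le_sup (f := W)
          (Finset.mem_erase.mpr ⟨hii, Finset.mem_univ i⟩)).trans le_sup_right hi)
    have h0 := hm i₀
    have hW0 := hW i₀
    refine exists_matrix_of_two_subspaces (by omega) (W i₀) B ?_ ?_ ?_ hi₀
      (Submodule.mem_sup_left (hcurve y ⟨s₀, t₀, c₀, hc₀, hy⟩)) (by omega) hmem'
    · intro h
      rw [h, finrank_top, Module.finrank_fin_fun] at hW0
      omega
    · intro h
      rw [h, finrank_top, Module.finrank_fin_fun] at hBfr
      omega
    · rw [eq_top_iff, ← hnd.span_eq_top, Submodule.span_le]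
      rintro _ ⟨z, hz, rfl⟩
      exact (hmem' z hz).elim (fun h => Submodule.mem_sup_left h)
        fun h => Submodule.mem_sup_right h
  · push Not at hyW
    refine exists_matrix_of_curve hd A hA W m hsum hW σ τ ?_ ?_ ?_ hc₀ hy hyW hmem
    · intro i
      rw [← hpA]
      exact smul_ne_zero (hc i) (p i).rep_nonzero
    · intro i
      rw [← hpA]
      exact (W i).smul_mem _ (hpmem i)
    · rw [eq_top_iff, ← hnd.span_eq_top, Submodule.span_le]
      rintro _ ⟨z, hz, rfl⟩
      rcases hmem z hz with h | ⟨i, hi⟩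
      · exact Submodule.mem_sup_left (hcurve z h)
      · exact Submodule.mem_sup_right (le_iSup W i hi)

/-- Let `n ≥ 2`, let `Z ⊂ ℙ_n` be a finite non-degenerate set of
points, and let `y ∈ ℙ_n` be a point not in `Z`. Then there exists a `2 × n` matrix
`M` of linear forms on `ℙ_n` with non-proportional (linearly independent) rows, whose
first row defines `y` and whose rank-1 locus contains `Z`, if and only if `Z` is
contained in a Kronecker–Weierstrass variety `Y` of some type `(d;s)` with either
`d > 0` and `y` lying on the rational normal curve part of `Y`, or `d = 0` and `y`
equal to the distinguished point of `Y`. -/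
theorem statement1 (k : Type*) [Field k] [IsAlgClosed k] (n : ℕ) (hn : 2 ≤ n)
    (Z : Set (Projectivization k (Fin (n + 1) → k))) (hfin : Z.Finite)
    (hnd : NonDegenerate k n Z)
    (y : Projectivization k (Fin (n + 1) → k)) (hy : y ∉ Z) :
    (∃ M : Fin 2 → Fin n → Module.Dual k (Fin (n + 1) → k),
        LinearIndependent k M ∧ RowDefinesPoint k n (M 0) y ∧
        ∀ z ∈ Z, InRankOneLocus k n M z) ↔
    (∃ (d s : ℕ) (Y : Set (Projectivization k (Fin (n + 1) → k))), Z ⊆ Y ∧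
        ((∃ C, IsKWpos k n d s Y C ∧ y ∈ C) ∨
          (d = 0 ∧ IsKW0 k n s Y y))) := by
  constructor
  · rintro ⟨M, hM, hrow, hZ⟩
    exact exists_kroneckerWeierstrass_of_matrix hnd hy hM hrow hZ
  · rintro ⟨d, s, Y, hZY, ⟨C, hY, hyC⟩ | ⟨-, hY⟩⟩
    · exact exists_matrix_of_isKWpos hnd hZY hY hyC
    · exact exists_matrix_of_isKW0 hn hnd hZY hY
end
end

section
/- Let n ≥ 2 and let Y ⊂ ℙ_n be a Kronecker–Weierstrass variety of type (d;s). Then there exists a nonzero homogeneous quadratic form q ∈ k[z₀,…,z_n] vanishing identically on Y; that is, every Kronecker–Weierstrass variety in ℙ_n is contained in a quadric hypersurface. -/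
noncomputable section

open scoped BigOperators

/-- A subspace of dimension `r + 1` is spanned by any given nonzero vector in it together with
`r` further vectors. -/
theorem exists_spanning_family_with_point {k V : Type*} [Field k] [AddCommGroup V] [Module k V]
    {r : ℕ} {W : Submodule k V} {p : V}
    (hW : Module.finrank k W = r + 1) (hpW : p ∈ W) (hp : p ≠ 0) :
    ∃ b : Fin r → V, ∀ v ∈ W, ∃ (c : k) (x : Fin r → k), v = c • p + ∑ j, x j • b j := by
  have : FiniteDimensional k W := Module.finite_of_finrank_eq_succ hW
  let w : W := ⟨p, hpW⟩
  have hw : w ≠ 0 := fun h => hp (congrArg Subtype.val h)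
  obtain ⟨U, hU⟩ := Submodule.exists_isCompl (k ∙ w)
  have hUr : Module.finrank k U = r := by
    have := Submodule.finrank_add_eq_of_isCompl hU
    rw [finrank_span_singleton hw] at this
    omega
  let B := Module.finBasisOfFinrankEq k U hUr
  refine ⟨fun j => ((B j : W) : V), fun v hv => ?_⟩
  have hmem : (⟨v, hv⟩ : W) ∈ (k ∙ w) ⊔ U := hU.sup_eq_top ▸ Submodule.mem_top
  obtain ⟨y, hy, u, hu, hyu⟩ := Submodule.mem_sup.1 hmem
  obtain ⟨c, rfl⟩ := Submodule.mem_span_singleton.1 hy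
  refine ⟨c, fun j => B.repr ⟨u, hu⟩ j, ?_⟩
  have hu' := congrArg (fun z : U => ((z : W) : V)) (B.sum_repr ⟨u, hu⟩)
  simp only [Submodule.coe_sum, Submodule.coe_smul] at hu'
  rw [hu']
  exact (congrArg Subtype.val hyu).symm

theorem bilin_apply_sum_smul_self {k V ι : Type*} [Field k] [AddCommGroup V] [Module k V]
    [Fintype ι] (B : V →ₗ[k] V →ₗ[k] k) (x : ι → k) (b : ι → V) :
    B (∑ j, x j • b j) (∑ j, x j • b j) = ∑ z : ι × ι, x z.1 * x z.2 * B (b z.1) (b z.2) := by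
  simp only [map_sum, LinearMap.sum_apply, map_smul, LinearMap.smul_apply, smul_eq_mul,
    Finset.mul_sum]
  rw [Finset.sum_comm, Fintype.sum_prod_type]
  exact Finset.sum_congr rfl fun i _ => Finset.sum_congr rfl fun j _ => by ring

/-- If a family of bilinear forms `β` is such that its parameter space has dimension larger than
the stated number of conditions, then some nonzero parameter yields a form whose associated
quadratic form vanishes on all the subspaces `W i`, and which satisfies all the conditions `φ`,
where `φ` is assumed to force vanishing at a nonzero point `p i` of each `W i`. -/
theorem exists_ne_zero_quadratic_vanishing {k E V κ ι : Type*} [Field k]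
    [AddCommGroup E] [Module k E] [FiniteDimensional k E]
    [AddCommGroup V] [Module k V] [FiniteDimensional k V] [Fintype κ] [Fintype ι]
    (β : E →ₗ[k] V →ₗ[k] V →ₗ[k] k) (φ : κ → E →ₗ[k] k)
    (r : ι → ℕ) (W : ι → Submodule k V) (p : ι → V)
    (hW : ∀ i, Module.finrank k (W i) = r i + 1) (hpW : ∀ i, p i ∈ W i) (hp : ∀ i, p i ≠ 0)
    (hφ : ∀ e, (∀ x, φ x e = 0) → ∀ i, β e (p i) (p i) = 0)
    (hcard : Fintype.card κ + ∑ i, (r i + (r i + 1).choose 2) < Module.finrank k E) :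
    ∃ e, e ≠ 0 ∧ (∀ x, φ x e = 0) ∧ ∀ i, ∀ v ∈ W i, β e v v = 0 := by
  have hb : ∀ i, ∃ b : Fin (r i) → V, ∀ v ∈ W i, ∃ (c : k) (x : Fin (r i) → k),
      v = c • p i + ∑ j, x j • b j :=
    fun i => exists_spanning_family_with_point (hW i) (hpW i) (hp i)
  choose b hb using hb
  let ev : V → V → E →ₗ[k] k := fun u v => (β.flip u).flip v
  have hev : ∀ u v e, ev u v e = β e u v := fun _ _ _ => rfl
  let ψ : (Σ i, Fin (r i) ⊕ Sym2 (Fin (r i))) → E →ₗ[k] k := fun z =>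
    Sum.elim (fun j => ev (p z.1) (b z.1 j) + ev (b z.1 j) (p z.1))
      (Sym2.lift ⟨fun j l => if j = l then ev (b z.1 j) (b z.1 j)
        else ev (b z.1 j) (b z.1 l) + ev (b z.1 l) (b z.1 j), by
          intro j l
          by_cases h : j = l
          · simp [h]
          · simp [h, Ne.symm h, add_comm]⟩) z.2
  let Φ : E →ₗ[k] (κ ⊕ (Σ i, Fin (r i) ⊕ Sym2 (Fin (r i))) → k) := LinearMap.pi (Sum.elim φ ψ)
  have hker : LinearMap.ker Φ ≠ ⊥ := by
    apply LinearMap.ker_ne_bot_of_finrank_lt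
    simpa [Sym2.card] using hcard
  obtain ⟨e, he, he0⟩ := Submodule.exists_mem_ne_zero_of_ne_bot hker
  have hall : ∀ z, Sum.elim φ ψ z e = 0 := fun z => congrFun (LinearMap.mem_ker.1 he) z
  have hφe : ∀ x, φ x e = 0 := fun x => hall (Sum.inl x)
  refine ⟨e, he0, hφe, fun i v hv => ?_⟩
  have h1 : ∀ j, β e (p i) (b i j) + β e (b i j) (p i) = 0 := fun j =>
    hall (Sum.inr ⟨i, Sum.inl j⟩)
  have h2 : ∀ j, β e (b i j) (b i j) = 0 := fun j => by
    simpa [ψ, hev] using hall (Sum.inr ⟨i, Sum.inr s(j, j)⟩)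
  have h3 : ∀ j l, β e (b i j) (b i l) + β e (b i l) (b i j) = 0 := fun j l => by
    by_cases h : j = l
    · simp [h, h2]
    · simpa [ψ, hev, h] using hall (Sum.inr ⟨i, Sum.inr s(j, l)⟩)
  obtain ⟨c, x, rfl⟩ := hb i v hv
  have hsum : β e (∑ j, x j • b i j) (∑ j, x j • b i j) = 0 := by
    rw [bilin_apply_sum_smul_self]
    refine Finset.sum_involution (fun z _ => z.swap) ?_ ?_ ?_ ?_
    · rintro ⟨j, l⟩ -
      simp only [Prod.fst_swap, Prod.snd_swap]
      linear_combination x j * x l * h3 j l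
    · rintro ⟨j, l⟩ - hne heq
      obtain rfl : l = j := congrArg Prod.fst heq
      simp [h2] at hne
    · simp
    · simp
  have hmix : β e (p i) (∑ j, x j • b i j) + β e (∑ j, x j • b i j) (p i) = 0 := by
    simp only [map_sum, LinearMap.sum_apply, map_smul, LinearMap.smul_apply, smul_eq_mul,
      ← Finset.sum_add_distrib, ← mul_add, h1, mul_zero, Finset.sum_const_zero]
  simp only [map_add, LinearMap.add_apply, map_smul, LinearMap.smul_apply, smul_eq_mul]
  linear_combination c * c * hφ e hφe i + c * hmix + hsum

/-- The bilinear form `(u, v) ↦ ∑ c_{ij} u_i v_j`, the sum running over `i ≤ j`. -/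
def upperBilin (k : Type*) [Field k] (m : ℕ) :
    ({z : Fin m × Fin m // z.1 ≤ z.2} → k) →ₗ[k] (Fin m → k) →ₗ[k] (Fin m → k) →ₗ[k] k :=
  Fintype.linearCombination k fun z =>
    (LinearMap.mul k k).compl₁₂ (LinearMap.proj z.1.1) (LinearMap.proj z.1.2)

theorem upperBilin_apply (k : Type*) [Field k] (m : ℕ)
    (c : {z : Fin m × Fin m // z.1 ≤ z.2} → k) (u v : Fin m → k) :
    upperBilin k m c u v = ∑ z, c z * (u z.1.1 * v z.1.2) := by
  simp [upperBilin, Fintype.linearCombination_apply, LinearMap.sum_apply]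

theorem finrank_upper_coefficients (k : Type*) [Field k] (m : ℕ) :
    Module.finrank k ({z : Fin m × Fin m // z.1 ≤ z.2} → k) = (m + 1).choose 2 := by
  rw [Module.finrank_fintype_fun_eq_card, ← Fintype.card_congr Sym2.sortEquiv, Sym2.card,
    Fintype.card_fin]

theorem injective_upper_exponent (m : ℕ) :
    Function.Injective fun z : {z : Fin m × Fin m // z.1 ≤ z.2} =>
      Finsupp.single z.1.1 1 + Finsupp.single z.1.2 1 := by
  intro z w h
  apply Sym2.sortEquiv.symm.injective
  have h' := congrArg Finsupp.toMultiset h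
  simp only [map_add, Finsupp.toMultiset_single, one_smul] at h'
  apply Sym2.equivMultiset _ |>.injective
  exact Subtype.ext h'

/-- The quadratic polynomial with coefficients `c_{ij}`, for `i ≤ j`. -/
def upperQuadratic (k : Type*) [Field k] (m : ℕ) (c : {z : Fin m × Fin m // z.1 ≤ z.2} → k) :
    MvPolynomial (Fin m) k :=
  ∑ z, MvPolynomial.monomial (Finsupp.single z.1.1 1 + Finsupp.single z.1.2 1) (c z)

theorem upperQuadratic_isHomogeneous (k : Type*) [Field k] (m : ℕ)
    (c : {z : Fin m × Fin m // z.1 ≤ z.2} → k) : (upperQuadratic k m c).IsHomogeneous 2 := by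
  refine MvPolynomial.IsHomogeneous.sum _ _ _ fun z _ => MvPolynomial.isHomogeneous_monomial _ ?_
  simp [map_add, Finsupp.degree_single]

theorem upperQuadratic_ne_zero (k : Type*) [Field k] (m : ℕ)
    {c : {z : Fin m × Fin m // z.1 ≤ z.2} → k} (hc : c ≠ 0) : upperQuadratic k m c ≠ 0 := by
  intro h
  apply hc
  funext z
  have hz := congrArg (MvPolynomial.coeff (Finsupp.single z.1.1 1 + Finsupp.single z.1.2 1)) h
  rw [upperQuadratic, MvPolynomial.coeff_sum, Finset.sum_eq_single z] at hz
  · simpa using hz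
  · intro w _ hw
    rw [MvPolynomial.coeff_monomial, if_neg fun h => hw (injective_upper_exponent m h)]
  · simp

theorem eval_upperQuadratic (k : Type*) [Field k] (m : ℕ)
    (c : {z : Fin m × Fin m // z.1 ≤ z.2} → k) (v : Fin m → k) :
    MvPolynomial.eval v (upperQuadratic k m c) = upperBilin k m c v v := by
  rw [upperBilin_apply, upperQuadratic, map_sum]
  refine Finset.sum_congr rfl fun z _ => ?_
  rw [MvPolynomial.eval_monomial, Finsupp.prod_add_index' (by simp) (by simp [pow_add])]
  simp

/-- Vanishing of a quadratic form on a rational curve of degree `d` is implied by `2 * d + 1`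
linear conditions. -/
theorem exists_conditions_of_rational_curve {k E V : Type*} [Field k]
    [AddCommGroup E] [Module k E] [AddCommGroup V] [Module k V]
    (β : E →ₗ[k] V →ₗ[k] V →ₗ[k] k) (d : ℕ) (A : (Fin (d + 1) → k) →ₗ[k] V) :
    ∃ φ : Fin (2 * d + 1) → E →ₗ[k] k, ∀ e, (∀ x, φ x e = 0) → ∀ s t : k,
      β e (A fun i => s ^ (d - (i : ℕ)) * t ^ (i : ℕ))
        (A fun i => s ^ (d - (i : ℕ)) * t ^ (i : ℕ)) = 0 := by
  let a : Fin (d + 1) → V := fun i => A (Pi.single i 1)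
  let g : Fin (d + 1) × Fin (d + 1) → Fin (2 * d + 1) := fun z => ⟨z.1 + z.2, by omega⟩
  refine ⟨fun x => ∑ z with g z = x, (β.flip (a z.1)).flip (a z.2), fun e he s t => ?_⟩
  have hA : (A fun i => s ^ (d - (i : ℕ)) * t ^ (i : ℕ)) =
      ∑ i : Fin (d + 1), (s ^ (d - (i : ℕ)) * t ^ (i : ℕ)) • a i := by
    rw [LinearMap.pi_apply_eq_sum_univ A]
    refine Finset.sum_congr rfl fun i _ => congrArg _ (congrArg A ?_)
    funext j
    simp [Pi.single_apply, eq_comm]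
  rw [hA, bilin_apply_sum_smul_self, ← Finset.sum_fiberwise _ g]
  refine Finset.sum_eq_zero fun x _ => ?_
  have hx := he x
  simp only [LinearMap.sum_apply, LinearMap.flip_apply] at hx
  trans s ^ (2 * d - (x : ℕ)) * t ^ (x : ℕ) * ∑ z with g z = x, β e (a z.1) (a z.2)
  · rw [Finset.mul_sum]
    refine Finset.sum_congr rfl fun z hz => ?_
    obtain rfl : g z = x := (Finset.mem_filter.1 hz).2
    have hexp : 2 * d - ((g z : Fin (2 * d + 1)) : ℕ) =
        (d - (z.1 : ℕ)) + (d - (z.2 : ℕ)) := by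
      simp only [g]
      omega
    rw [hexp, pow_add, show ((g z : Fin (2 * d + 1)) : ℕ) = z.1 + z.2 from rfl, pow_add]
    ring
  · rw [hx, mul_zero]

theorem quadric_count {n d s : ℕ} (hn : 2 ≤ n) (r : Fin s → ℕ)
    (hr : ∀ i, r i ≤ n - 1) (hsum : d + ∑ i, r i = n) :
    2 * d + 1 + ∑ i, (r i + (r i + 1).choose 2) < (n + 2).choose 2 := by
  have two_choose : ∀ m : ℕ, 2 * (m + 1).choose 2 = m * (m + 1) := fun m => by
    rw [Nat.choose_two_right, Nat.mul_div_cancel' (Nat.even_mul_pred_self _).two_dvd,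
      Nat.add_sub_cancel, mul_comm]
  have hS : 2 * ∑ i, (r i + (r i + 1).choose 2) = ∑ i, r i ^ 2 + 3 * ∑ i, r i := by
    rw [Finset.mul_sum, Finset.mul_sum, ← Finset.sum_add_distrib]
    refine Finset.sum_congr rfl fun i _ => ?_
    rw [mul_add, two_choose]
    ring
  have hmain : d + ∑ i, r i ^ 2 < n ^ 2 := by
    have hle : ∑ i, r i ^ 2 ≤ (∑ i, r i) ^ 2 :=
      Finset.sum_sq_le_sq_sum_of_nonneg fun _ _ => Nat.zero_le _
    rcases Nat.eq_zero_or_pos d with rfl | hd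
    · have : ∑ i, r i ^ 2 ≤ (n - 1) * ∑ i, r i := by
        rw [Finset.mul_sum]
        refine Finset.sum_le_sum fun i _ => ?_
        rw [sq]
        exact Nat.mul_le_mul_right _ (hr i)
      obtain ⟨m, rfl⟩ : ∃ m, n = m + 1 := ⟨n - 1, by omega⟩
      simp only [zero_add, Nat.add_sub_cancel] at *
      rw [hsum] at this
      nlinarith
    · generalize ∑ i, r i = S at *
      subst hsum
      rcases Nat.lt_or_ge 1 d with h | h
      · nlinarith
      · obtain rfl : d = 1 := by omega
        nlinarith
  have := two_choose (n + 1)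
  nlinarith

/-- A nonzero quadratic form may be found which vanishes on given subspaces, provided suitable
linear conditions `φ` are few enough and force vanishing at a nonzero vector of each subspace. -/
theorem exists_quadric_of_conditions (k : Type*) [Field k] {n d s : ℕ} (hn : 2 ≤ n)
    {κ : Type*} [Fintype κ] (hκ : Fintype.card κ ≤ 2 * d + 1)
    (φ : κ → ({z : Fin (n + 1) × Fin (n + 1) // z.1 ≤ z.2} → k) →ₗ[k] k)
    (r : Fin s → ℕ) (W : Fin s → Submodule k (Fin (n + 1) → k)) (p : Fin s → Fin (n + 1) → k)
    (hr : ∀ i, r i ≤ n - 1) (hsum : d + ∑ i, r i = n)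
    (hW : ∀ i, Module.finrank k (W i) = r i + 1) (hpW : ∀ i, p i ∈ W i) (hp : ∀ i, p i ≠ 0)
    (hφ : ∀ e, (∀ x, φ x e = 0) → ∀ i, upperBilin k (n + 1) e (p i) (p i) = 0) :
    ∃ e, (∀ x, φ x e = 0) ∧ upperQuadratic k (n + 1) e ≠ 0 ∧
      ∀ i, ∀ v ∈ W i, MvPolynomial.eval v (upperQuadratic k (n + 1) e) = 0 := by
  obtain ⟨e, he0, heφ, heW⟩ := exists_ne_zero_quadratic_vanishing (upperBilin k (n + 1)) φ r W p
    hW hpW hp hφ (by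
      rw [finrank_upper_coefficients]
      exact lt_of_le_of_lt (Nat.add_le_add_right hκ _) (quadric_count hn r hr hsum))
  refine ⟨e, heφ, upperQuadratic_ne_zero k _ he0, fun i v hv => ?_⟩
  rw [eval_upperQuadratic]
  exact heW i v hv

/-- Let `n ≥ 2` and let `Y ⊆ ℙ_n` be a Kronecker–Weierstrass
variety of type `(d;s)`. Then there exists a nonzero homogeneous quadratic form
`q ∈ k[z₀,…,z_n]` vanishing identically on `Y`: every Kronecker–Weierstrass variety
in `ℙ_n` is contained in a quadric hypersurface. -/
theorem statement4 (k : Type*) [Field k] [IsAlgClosed k] (n : ℕ) (hn : 2 ≤ n)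
    (d s : ℕ) (Y : Set (Projectivization k (Fin (n + 1) → k)))
    (hY : (∃ C, IsKWpos k n d s Y C) ∨ (d = 0 ∧ ∃ y, IsKW0 k n s Y y)) :
    ∃ q : MvPolynomial (Fin (n + 1)) k, q ≠ 0 ∧ q.IsHomogeneous 2 ∧
      ∀ x ∈ Y, MvPolynomial.eval x.rep q = 0 := by
  rcases hY with ⟨C, -, r, L, W, hr, hsum, ⟨A, -, -, hC⟩, hW, hLW, -, rfl⟩ |
    ⟨rfl, y, r, W, hr, hsum, hW, hy, -, rfl⟩
  · obtain ⟨φ, hφ⟩ := exists_conditions_of_rational_curve (upperBilin k (n + 1)) d A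
    have hφC : ∀ e, (∀ x, φ x e = 0) → ∀ x ∈ C, upperBilin k (n + 1) e x.rep x.rep = 0 := by
      intro e he x hx
      rw [hC] at hx
      obtain ⟨a, b, c, hc, hx⟩ := hx
      have h := hφ e he a b
      rw [← hx] at h
      simpa [hc] using h
    choose p hpC hp using hLW
    obtain ⟨e, he, hq, hqW⟩ := exists_quadric_of_conditions k hn (by simp) φ r W
      (fun i => (p i).rep) (fun i => (hr i).2) hsum hW
      (fun i => ((hp i).symm ▸ Set.mem_singleton (p i) : p i ∈ projSet k L ∩ projSet k (W i)).2)
      (fun i => (p i).rep_nonzero) (fun e he i => hφC e he _ (hpC i))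
    refine ⟨_, hq, upperQuadratic_isHomogeneous k _ e, ?_⟩
    rintro x (hx | hx)
    · rw [eval_upperQuadratic]
      exact hφC e he x hx
    · obtain ⟨i, hi⟩ := Set.mem_iUnion.1 hx
      exact hqW i _ hi
  · obtain ⟨e, -, hq, hqW⟩ := exists_quadric_of_conditions k (d := 0) (κ := Unit) hn (by simp)
      (fun _ => ((upperBilin k (n + 1)).flip y.rep).flip y.rep) r W (fun _ => y.rep)
      (fun i => (hr i).2) (by omega) hW hy (fun _ => y.rep_nonzero) (fun _ he _ => he ())
    refine ⟨_, hq, upperQuadratic_isHomogeneous k _ e, fun x hx => ?_⟩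
    obtain ⟨i, hi⟩ := Set.mem_iUnion.1 hx
    exact hqW i _ hi
end
end
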